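/- Let 0 < α < 1 and define φ(z) = (1 + (1 − z)^α)^{−1} for z ∈ 𝔻, where (1 − z)^α = exp(α·Log(1 − z)) with Log the principal branch of the logarithm (note Re(1 − z) > 0 on 𝔻, and φ maps 𝔻 into 𝔻). Let T = C_φ be the associated composition operator on ℓ². Then there exist constants c, C > 0 such that for every integer n ≥ 1: c·exp(−π(1−α)·√(2n/α)) ≤ a_n(T) ≤ C·exp(−π(1−α)·√(n/(2α))). -/

import Mathlib

open Complex MeasureTheory Filter Set

noncomputable section

abbrev H2 : Type := lp (fun _ : ℕ => ℂ) 2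

noncomputable def fa (a : H2) (z : ℂ) : ℂ := ∑' k : ℕ, a k * z ^ k

noncomputable def approxNum (T : H2 →L[ℂ] H2) (n : ℕ) : ℝ :=
  sInf {c : ℝ | ∃ R : H2 →L[ℂ] H2,
    FiniteDimensional ℂ (LinearMap.range R.toLinearMap) ∧
    Module.finrank ℂ (LinearMap.range R.toLinearMap) ≤ n - 1 ∧ c = ‖T - R‖}

lemma h2_summable (x : H2) : Summable (fun k => ‖x k‖ ^ 2) := by
  have := (lp.memℓp x).summable (by norm_num)
  simpa using this

lemma h2_norm_sq (x : H2) : ‖x‖ ^ 2 = ∑' k, ‖x k‖ ^ 2 := by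
  have := lp.norm_rpow_eq_tsum (p := 2) (by norm_num) x
  simpa using this

def mkH2 (f : ℕ → ℂ) (hf : Summable (fun k => ‖f k‖ ^ 2)) : H2 :=
  ⟨f, memℓp_gen (by simpa using hf)⟩

lemma mkH2_apply (f : ℕ → ℂ) (hf) (k : ℕ) : mkH2 f hf k = f k := rfl

def shiftFun (f : ℕ → ℂ) : ℕ → ℂ
  | 0 => 0
  | k + 1 => f k

lemma shift_summable (x : H2) : Summable (fun k => ‖shiftFun x k‖ ^ 2) := by
  rw [← summable_nat_add_iff 1]
  simpa [shiftFun] using h2_summable x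

def shiftIso : H2 →ₗᵢ[ℂ] H2 where
  toFun x := mkH2 (shiftFun x) (shift_summable x)
  map_add' x y := by
    ext k; cases k <;> simp [mkH2_apply, shiftFun]
  map_smul' c x := by
    ext k; cases k <;> simp [mkH2_apply, shiftFun]
  norm_map' x := by
    have h : ‖mkH2 (shiftFun x) (shift_summable x)‖ ^ 2 = ‖x‖ ^ 2 := by
      rw [h2_norm_sq, h2_norm_sq]
      have e : ∀ k, mkH2 (shiftFun x) (shift_summable x) k = shiftFun x k := fun k => rfl
      simp only [e]
      rw [(shift_summable x).tsum_eq_zero_add]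
      simp [shiftFun]
    exact (sq_eq_sq₀ (norm_nonneg _) (norm_nonneg _)).1 h

def Sh : H2 →L[ℂ] H2 := shiftIso.toContinuousLinearMap

lemma Sh_norm (x : H2) : ‖Sh x‖ = ‖x‖ := shiftIso.norm_map x
lemma Sh_zero (x : H2) : Sh x 0 = 0 := rfl
lemma Sh_succ (x : H2) (k : ℕ) : Sh x (k + 1) = x k := rfl

lemma geom_sq_summable {z : ℂ} (hz : ‖z‖ < 1) : Summable (fun k : ℕ => ‖z ^ k‖ ^ 2) := by
  have : (fun k : ℕ => ‖z ^ k‖ ^ 2) = fun k => (‖z‖ ^ 2) ^ k := by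
    ext k; rw [norm_pow, ← pow_mul, ← pow_mul, mul_comm]
  rw [this]
  exact summable_geometric_of_lt_one (by positivity) (by nlinarith [norm_nonneg z])

/-- reproducing kernel -/
def krn (z : ℂ) (hz : ‖z‖ < 1) : H2 :=
  mkH2 (fun k => (starRingEnd ℂ z) ^ k) (geom_sq_summable (by simpa using hz))

lemma krn_apply (z : ℂ) (hz : ‖z‖ < 1) (k : ℕ) : krn z hz k = (starRingEnd ℂ z) ^ k := rfl

lemma krn_norm_sq (z : ℂ) (hz : ‖z‖ < 1) : ‖krn z hz‖ ^ 2 = (1 - ‖z‖ ^ 2)⁻¹ := by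
  rw [h2_norm_sq]
  have : (fun k : ℕ => ‖krn z hz k‖ ^ 2) = fun k => (‖z‖ ^ 2) ^ k := by
    ext k; rw [krn_apply, norm_pow, RCLike.norm_conj, ← pow_mul, ← pow_mul, mul_comm]
  rw [this, tsum_geometric_of_lt_one (by positivity) (by nlinarith [norm_nonneg z])]

lemma fa_eq_inner (z : ℂ) (hz : ‖z‖ < 1) (x : H2) : fa x z = inner ℂ (krn z hz) x := by
  rw [lp.inner_eq_tsum, fa]
  congr 1; ext k
  simp [krn_apply]

lemma fa_hasSum (z : ℂ) (hz : ‖z‖ < 1) (x : H2) : HasSum (fun k => x k * z ^ k) (fa x z) := by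
  have := lp.hasSum_inner (𝕜 := ℂ) (krn z hz) x
  rw [← fa_eq_inner] at this
  have e : (fun k => x k * z ^ k) = fun k => inner ℂ (krn z hz k) (x k) := by
    funext k
    simp [krn_apply]
  rw [e]; exact this

lemma fa_bound (z : ℂ) (hz : ‖z‖ < 1) (x : H2) : ‖fa x z‖ ≤ ‖krn z hz‖ * ‖x‖ := by
  rw [fa_eq_inner z hz]; exact norm_inner_le_norm _ _

lemma fa_krn_self (z : ℂ) (hz : ‖z‖ < 1) : fa (krn z hz) z = (‖krn z hz‖ ^ 2 : ℝ) := by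
  rw [fa_eq_inner z hz, inner_self_eq_norm_sq_to_K]; norm_num

lemma fa_add (x y : H2) (z : ℂ) (hz : ‖z‖ < 1) : fa (x + y) z = fa x z + fa y z := by
  simp only [fa_eq_inner z hz, inner_add_right]
lemma fa_sub (x y : H2) (z : ℂ) (hz : ‖z‖ < 1) : fa (x - y) z = fa x z - fa y z := by
  simp only [fa_eq_inner z hz, inner_sub_right]
lemma fa_smul (c : ℂ) (y : H2) (z : ℂ) (hz : ‖z‖ < 1) : fa (c • y) z = c * fa y z := by
  simp only [fa_eq_inner z hz, inner_smul_right]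

lemma fa_Sh (x : H2) (z : ℂ) (hz : ‖z‖ < 1) : fa (Sh x) z = z * fa x z := by
  unfold fa
  rw [(fa_hasSum z hz (Sh x)).summable.tsum_eq_zero_add, ← tsum_mul_left]
  simp only [Sh_zero, Sh_succ, zero_mul, zero_add]
  congr 1; ext k; ring

/-- the properties of multiplication by a finite Blaschke product -/
def IsMul (l : List ℂ) (M : H2 →L[ℂ] H2) : Prop :=
  (∀ x, ‖M x‖ = ‖x‖) ∧
  (∀ x z, ‖z‖ < 1 → fa (M x) z =
    (l.map (fun a => (z - a) / (1 - (starRingEnd ℂ a) * z))).prod * fa x z) ∧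
  ∃ P D : H2 →L[ℂ] H2, LinearMap.rank P.toLinearMap ≤ l.length ∧ (∀ x, ‖D x‖ ≤ ‖x‖) ∧
    ∀ f, f = P f + M (D f)

lemma one_sub_ne {a z : ℂ} (ha : ‖a‖ < 1) (hz : ‖z‖ < 1) : 1 - (starRingEnd ℂ a) * z ≠ 0 := by
  intro h
  have h1 : (starRingEnd ℂ a) * z = 1 := (sub_eq_zero.1 h).symm
  have h2 : ‖a‖ * ‖z‖ = 1 := by
    have := congrArg norm h1
    simpa using this
  nlinarith [norm_nonneg a, norm_nonneg z]

lemma mulOne (a : ℂ) (ha : ‖a‖ < 1) : ∃ M, IsMul [a] M := by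
  have hS : ‖(starRingEnd ℂ a) • Sh‖ < 1 := by
    have : ‖Sh‖ ≤ 1 := ContinuousLinearMap.opNorm_le_bound _ (by norm_num) (fun x => by simp [Sh_norm])
    rw [norm_smul, RCLike.norm_conj]
    nlinarith [norm_nonneg a, norm_nonneg Sh]
  obtain ⟨U, hU⟩ := isUnit_one_sub_of_norm_lt_one hS
  set N : H2 →L[ℂ] H2 := ((U⁻¹ : (H2 →L[ℂ] H2)ˣ) : H2 →L[ℂ] H2) with hN
  have hUN : ∀ x, N x - (starRingEnd ℂ a) • Sh (N x) = x := by
    intro x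
    have : ((U : H2 →L[ℂ] H2) * N) x = x := by rw [hN, Units.mul_inv]; rfl
    rw [hU] at this
    simpa using this
  have hNU : ∀ x, N (x - (starRingEnd ℂ a) • Sh x) = x := by
    intro x
    have : (N * (U : H2 →L[ℂ] H2)) x = x := by rw [hN, Units.inv_mul]; rfl
    rw [hU] at this
    simpa using this
  set M : H2 →L[ℂ] H2 := (Sh - a • 1) * N with hM
  have hMx : ∀ x, M x = Sh (N x) - a • N x := fun x => by simp [hM]
  have hiso : ∀ y : H2, ‖Sh y - a • y‖ = ‖y - (starRingEnd ℂ a) • Sh y‖ := by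
    intro y
    have : ‖Sh y - a • y‖ ^ 2 = ‖y - (starRingEnd ℂ a) • Sh y‖ ^ 2 := by
      rw [@norm_sub_sq ℂ, @norm_sub_sq ℂ]
      simp only [inner_smul_right, norm_smul, Sh_norm, RCLike.norm_conj]
      have : RCLike.re (a * inner ℂ (Sh y) y) = RCLike.re ((starRingEnd ℂ a) * inner ℂ y (Sh y)) := by
        rw [← inner_conj_symm y (Sh y), ← map_mul, RCLike.conj_re]
      rw [this]
    exact (sq_eq_sq₀ (norm_nonneg _) (norm_nonneg _)).1 this
  have hMn : ∀ x, ‖M x‖ = ‖x‖ := by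
    intro x; rw [hMx, hiso, hUN]
  refine ⟨M, hMn, ?_, ?_⟩
  · intro x z hz
    have h1 : fa x z = (1 - (starRingEnd ℂ a) * z) * fa (N x) z := by
      conv_lhs => rw [← hUN x]
      rw [fa_sub _ _ _ hz, fa_smul _ _ _ hz, fa_Sh _ _ hz]; ring
    rw [hMx, fa_sub _ _ _ hz, fa_smul _ _ _ hz, fa_Sh _ _ hz, h1]
    have := one_sub_ne ha hz
    simp only [List.map_cons, List.map_nil, List.prod_cons, List.prod_nil, mul_one]
    rw [← mul_assoc, div_mul_cancel₀ _ this]; ring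
  · set D := ContinuousLinearMap.adjoint M with hD
    refine ⟨1 - M * D, D, ?_, ?_, ?_⟩
    · have hDM : ∀ x, D (M x) = x := by
        intro x
        apply ext_inner_left ℂ
        intro v
        rw [hD, ContinuousLinearMap.adjoint_inner_right]
        exact (LinearMap.norm_map_iff_inner_map_map M).1 hMn v x
      have hsub : LinearMap.range ((1 - M * D : H2 →L[ℂ] H2)).toLinearMap ≤ Submodule.span ℂ {krn a ha} := by
        rintro _ ⟨x, rfl⟩
        set h : H2 := ((1 - M * D : H2 →L[ℂ] H2)).toLinearMap x with hh
        have hDh : D h = 0 := by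
          have : h = x - M (D x) := by simp [hh]
          rw [this, map_sub, hDM, sub_self]
        have hort : ∀ y : H2, inner ℂ (Sh y - a • y) h = 0 := by
          intro y
          have : M (y - (starRingEnd ℂ a) • Sh y) = Sh y - a • y := by
            rw [hMx, hNU]
          rw [← this, ← ContinuousLinearMap.adjoint_inner_right, ← hD, hDh, inner_zero_right]
        have hrec : ∀ k, h (k + 1) = (starRingEnd ℂ a) * h k := by
          intro k
          have h1 := hort (lp.single 2 k 1)
          have h2 : Sh (lp.single 2 k (1:ℂ) : H2) = lp.single 2 (k + 1) (1:ℂ) := by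
            ext j
            rcases j with _ | j
            · rw [Sh_zero]; simp
            · rw [Sh_succ]; simp [Pi.single_apply]
          rw [h2, inner_sub_left, inner_smul_left, lp.inner_single_left, lp.inner_single_left] at h1
          simp at h1
          linear_combination h1
        rw [Submodule.mem_span_singleton]
        refine ⟨h 0, ?_⟩
        ext k
        simp only [lp.coeFn_smul, Pi.smul_apply, krn_apply, smul_eq_mul]
        induction k with
        | zero => simp
        | succ k ih => rw [hrec, ← ih]; ring
      calc LinearMap.rank ((1 - M * D : H2 →L[ℂ] H2)).toLinearMap
          ≤ Module.rank ℂ (Submodule.span ℂ {krn a ha}) := Submodule.rank_mono hsub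
        _ ≤ Cardinal.mk ({krn a ha} : Set H2) := rank_span_le _
        _ = _ := by simp
    · intro x
      have : ‖M‖ ≤ 1 := ContinuousLinearMap.opNorm_le_bound _ (by norm_num) (fun x => by simp [hMn])
      calc ‖D x‖ ≤ ‖D‖ * ‖x‖ := D.le_opNorm x
        _ ≤ 1 * ‖x‖ := by
          gcongr
          rw [hD, LinearIsometryEquiv.norm_map]; exact this
        _ = _ := one_mul _
    · intro f; simp

lemma mulList (l : List ℂ) (hl : ∀ a ∈ l, ‖a‖ < 1) : ∃ M, IsMul l M := by
  induction l with
  | nil =>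
    refine ⟨1, by simp, by simp, 0, 1, ?_, by simp, by simp⟩
    simp
  | cons a l ih =>
    obtain ⟨M2, h1, h2, P2, D2, h3, h4, h5⟩ := ih (fun b hb => hl b (List.mem_cons_of_mem _ hb))
    obtain ⟨M1, k1, k2, P1, D1, k3, k4, k5⟩ := mulOne a (hl a (List.mem_cons_self))
    refine ⟨M1 * M2, ?_, ?_, P1 + M1 * P2 * D1, D2 * D1, ?_, ?_, ?_⟩
    · intro x; simp [k1, h1]
    · intro x z hz
      rw [mul_apply_eq_comp, k2 _ _ hz, h2 _ _ hz]
      simp [mul_assoc]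
    · have e : (P1 + M1 * P2 * D1 : H2 →L[ℂ] H2).toLinearMap = P1.toLinearMap +
        M1.toLinearMap.comp (P2.toLinearMap.comp D1.toLinearMap) := by
        ext x; simp
      rw [e]
      refine (LinearMap.rank_add_le _ _).trans ?_
      have e2 := (LinearMap.rank_comp_le_right (P2.toLinearMap.comp D1.toLinearMap) M1.toLinearMap).trans
        ((LinearMap.rank_comp_le_left D1.toLinearMap P2.toLinearMap).trans h3)
      refine (add_le_add k3 e2).trans ?_
      simp [add_comm]
    · intro x; exact (h4 _).trans (k4 _)
    · intro f
      have := k5 f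
      have h' := h5 (D1 f)
      calc f = P1 f + M1 (D1 f) := this
        _ = P1 f + M1 (P2 (D1 f) + M2 (D2 (D1 f))) := by rw [← h']
        _ = _ := by simp [add_assoc]


def zc (r t : ℝ) : ℂ := r * Complex.exp (t * I)

lemma zc_norm (r t : ℝ) (hr : 0 ≤ r) : ‖zc r t‖ = r := by
  simp [zc, Complex.norm_exp_ofReal_mul_I, abs_of_nonneg hr]

lemma zc_cont (r : ℝ) : Continuous (zc r) := by unfold zc; fun_prop

lemma coeff_summable (x : H2) (r : ℝ) (hr : 0 ≤ r) (hr1 : r < 1) :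
    Summable (fun k => ‖x k‖ * r ^ k) := by
  have := (fa_hasSum (r : ℂ) (by simpa [abs_of_nonneg hr]) x).summable.norm
  simpa [abs_of_nonneg hr] using this

lemma poly_parseval (x : H2) (r : ℝ) (N : ℕ) :
    2 * Real.pi * ∑ k ∈ Finset.range N, ‖x k * r ^ k‖ ^ 2 =
      ∫ t in (0:ℝ)..2 * Real.pi, ‖∑ k ∈ Finset.range N, x k * zc r t ^ k‖ ^ 2 := by
  set p : Polynomial ℂ := ∑ k ∈ Finset.range N, Polynomial.monomial k (x k * r ^ k) with hp
  have hco : ∀ i, p.coeff i = if i ∈ Finset.range N then x i * r ^ i else 0 := by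
    intro i
    simp only [hp, Polynomial.finsetSum_coeff, Polynomial.coeff_monomial]
    rw [Finset.sum_ite_eq']
  have h := p.sum_sq_norm_coeff_eq_circleAverage
  have h1 : ∑ i ∈ p.support, ‖p.coeff i‖ ^ 2 = ∑ k ∈ Finset.range N, ‖x k * r ^ k‖ ^ 2 := by
    have : p.support ⊆ Finset.range N := by
      intro i hi
      by_contra hc
      rw [Polynomial.mem_support_iff, hco, if_neg hc] at hi
      exact hi rfl
    rw [Finset.sum_subset this]
    · exact Finset.sum_congr rfl (fun i hi => by rw [hco, if_pos hi])
    · intro i _ hi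
      rw [Polynomial.notMem_support_iff.1 hi]; simp
  have h2 : ∀ t : ℝ, p.eval (circleMap 0 1 t) = ∑ k ∈ Finset.range N, x k * zc r t ^ k := by
    intro t
    rw [hp, Polynomial.eval_finsetSum]
    refine Finset.sum_congr rfl fun k _ => ?_
    simp [circleMap, zc]; ring
  rw [h1, Real.circleAverage_def] at h
  rw [h, smul_eq_mul, ← mul_assoc, mul_inv_cancel₀ (by positivity), one_mul]
  simp only [h2]

lemma fa_cont (x : H2) (r : ℝ) (hr : 0 ≤ r) (hr1 : r < 1) : Continuous (fun t => fa x (zc r t)) := by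
  unfold fa
  refine continuous_tsum (u := fun k => ‖x k‖ * r ^ k) ?_ (coeff_summable x r hr hr1) ?_
  · intro k; exact continuous_const.mul ((zc_cont r).pow k)
  · intro k t; rw [norm_mul, norm_pow, zc_norm r t hr]

lemma partial_le (x : H2) (r : ℝ) (hr : 0 ≤ r) (hr1 : r < 1) (N : ℕ) :
    2 * Real.pi * ∑ k ∈ Finset.range N, ‖x k * r ^ k‖ ^ 2 ≤
      ∫ t in (0:ℝ)..2 * Real.pi, ‖fa x (zc r t)‖ ^ 2 := by
  set B := ∑' k, ‖x k‖ * r ^ k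
  have hs := coeff_summable x r hr hr1
  have hlim : Tendsto (fun N : ℕ => ∫ t in (0:ℝ)..2 * Real.pi, ‖∑ k ∈ Finset.range N, x k * zc r t ^ k‖ ^ 2)
      atTop (nhds (∫ t in (0:ℝ)..2 * Real.pi, ‖fa x (zc r t)‖ ^ 2)) := by
    refine intervalIntegral.tendsto_integral_filter_of_dominated_convergence (fun _ => B ^ 2) ?_ ?_ ?_ ?_
    · refine Eventually.of_forall fun N => Continuous.aestronglyMeasurable ?_
      have := zc_cont r
      fun_prop
    · refine Eventually.of_forall fun N => Eventually.of_forall fun t _ => ?_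
      rw [Real.norm_of_nonneg (by positivity)]
      gcongr
      refine (norm_sum_le _ _).trans ?_
      simp only [norm_mul, norm_pow, zc_norm r t hr]
      exact hs.sum_le_tsum _ (fun i _ => by positivity)
    · exact intervalIntegrable_const
    · refine Eventually.of_forall fun t _ => ?_
      have := (fa_hasSum (zc r t) (by rw [zc_norm r t hr]; exact hr1) x).tendsto_sum_nat
      exact (this.norm).pow 2
  refine ge_of_tendsto hlim ?_
  filter_upwards [eventually_ge_atTop N] with m hm
  rw [← poly_parseval]
  gcongr

lemma norm_sq_le (x : H2) (G : ℝ → ENNReal)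
    (h : ∀ r t : ℝ, 1 / 4 ≤ r → r < 1 → 0 < t → t ≤ Real.pi →
      ENNReal.ofReal (‖fa x (zc r t)‖ ^ 2) ≤ G t ∧ ENNReal.ofReal (‖fa x (zc r (-t))‖ ^ 2) ≤ G t) :
    ENNReal.ofReal (‖x‖ ^ 2) ≤ ∫⁻ t in Ioc 0 Real.pi, G t := by
  set A := ∫⁻ t in Ioc 0 Real.pi, G t with hA
  by_cases htop : A = ⊤
  · rw [htop]; exact le_top
  have key : ∀ r : ℝ, 1 / 4 ≤ r → r < 1 → ∀ N : ℕ,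
      2 * Real.pi * ∑ k ∈ Finset.range N, ‖x k * r ^ k‖ ^ 2 ≤ 2 * A.toReal := by
    intro r hr hr1 N
    refine (partial_le x r (by linarith) hr1 N).trans ?_
    set F : ℝ → ℝ := fun t => ‖fa x (zc r t)‖ ^ 2 with hF
    have hFc : Continuous F := ((fa_cont x r (by linarith) hr1).norm).pow 2
    have hper : Function.Periodic F (2 * Real.pi) := by
      intro t
      simp only [hF, zc]
      have : Complex.exp ((((t + 2 * Real.pi : ℝ)) : ℂ) * I) = Complex.exp (t * I) := by
        push_cast
        rw [add_mul]; exact Complex.exp_periodic _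
      rw [this]
    have e1 : ∫ t in (0:ℝ)..2 * Real.pi, F t = ∫ t in (-Real.pi)..Real.pi, F t := by
      have := hper.intervalIntegral_add_eq 0 (-Real.pi)
      rw [zero_add] at this
      rw [this]; congr 1; ring
    have half : ∀ H : ℝ → ℝ, Continuous H → (∀ t, 0 ≤ H t) →
        (∀ t, 0 < t → t ≤ Real.pi → ENNReal.ofReal (H t) ≤ G t) →
        ∫ t in (0:ℝ)..Real.pi, H t ≤ A.toReal := by
      intro H hc h0 hG
      rw [intervalIntegral.integral_of_le Real.pi_pos.le]
      rw [integral_eq_lintegral_of_nonneg_ae (Eventually.of_forall h0) hc.aestronglyMeasurable]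
      refine ENNReal.toReal_mono htop ?_
      refine setLIntegral_mono' measurableSet_Ioc ?_
      intro t ht; exact hG t ht.1 ht.2
    have e2 : ∫ t in (-Real.pi)..Real.pi, F t =
        (∫ t in (0:ℝ)..Real.pi, F (-t)) + ∫ t in (0:ℝ)..Real.pi, F t := by
      rw [intervalIntegral.integral_comp_neg, neg_zero]
      exact (intervalIntegral.integral_add_adjacent_intervals (hFc.intervalIntegrable _ _)
        (hFc.intervalIntegrable _ _)).symm
    rw [e1, e2]
    have b1 := half F hFc (fun t => by positivity) (fun t h0 h1 => (h r t hr hr1 h0 h1).1)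
    have b2 := half (fun t => F (-t)) (hFc.comp continuous_neg) (fun t => by positivity)
      (fun t h0 h1 => (h r t hr hr1 h0 h1).2)
    linarith
  have key2 : ∀ N : ℕ, 2 * Real.pi * ∑ k ∈ Finset.range N, ‖x k‖ ^ 2 ≤ 2 * A.toReal := by
    intro N
    have hc : Continuous (fun r : ℝ => 2 * Real.pi * ∑ k ∈ Finset.range N, ‖x k * (r:ℂ) ^ k‖ ^ 2) := by
      fun_prop
    have hl := (hc.tendsto 1).mono_left (nhdsWithin_le_nhds (s := Iio 1))
    simp only [ofReal_one, one_pow, mul_one] at hl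
    refine le_of_tendsto hl ?_
    filter_upwards [Ioo_mem_nhdsLT (show (1/4:ℝ) < 1 by norm_num)] with r hr
    exact key r hr.1.le hr.2 N
  have h3 : ‖x‖ ^ 2 ≤ A.toReal / Real.pi := by
    rw [h2_norm_sq]
    refine (h2_summable x).tsum_le_of_sum_range_le ?_
    intro N
    rw [le_div_iff₀ Real.pi_pos]
    linarith [key2 N]
  have h4 : A.toReal / Real.pi ≤ A.toReal := by
    refine div_le_self ENNReal.toReal_nonneg ?_
    linarith [Real.pi_gt_three]
  exact ENNReal.ofReal_le_of_le_toReal (h3.trans h4)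


lemma gamma_integrable {p q b : ℝ} (hp : 0 < p) (hq : -1 < q) (hb : 0 < b) :
    IntegrableOn (fun x : ℝ => x ^ q * Real.exp (-b * x ^ p)) (Ioi 0) := by
  by_contra h
  have h1 := integral_rpow_mul_exp_neg_mul_rpow hp hq hb
  rw [integral_undef h] at h1
  have : 0 < b ^ (-(q + 1) / p) * (1 / p) * Real.Gamma ((q + 1) / p) := by
    have := Real.Gamma_pos_of_pos (show 0 < (q + 1) / p from div_pos (by linarith) hp)
    positivity
  linarith

lemma sum_half (b : ℝ) (hb : 0 < b) (N : ℕ) :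
    ∑ k ∈ Finset.range N, ((k : ℝ) + 1) ^ (-(1 / 2) : ℝ) * Real.exp (-b * (k + 1)) ≤
      Real.Gamma (1 / 2) * b ^ (-(1 / 2) : ℝ) := by
  set f : ℝ → ℝ := fun x => x ^ (-(1 / 2) : ℝ) * Real.exp (-b * x) with hf
  have hIntg : IntegrableOn f (Ioi 0) := by
    have := gamma_integrable (p := 1) (q := -(1/2)) (b := b) one_pos (by norm_num) hb
    simp only [Real.rpow_one] at this
    exact this
  have hval : ∫ x in Ioi 0, f x = Real.Gamma (1 / 2) * b ^ (-(1 / 2) : ℝ) := by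
    have := integral_rpow_mul_exp_neg_mul_rpow (p := 1) (q := -(1/2)) (b := b) one_pos (by norm_num) hb
    simp only [Real.rpow_one] at this
    rw [hf, this]
    norm_num [mul_comm]
  have hii : ∀ a c : ℝ, 0 ≤ a → a ≤ c → IntervalIntegrable f volume a c := by
    intro a c ha hac
    rw [intervalIntegrable_iff_integrableOn_Ioc_of_le hac]
    exact hIntg.mono_set (fun x hx => lt_of_le_of_lt ha hx.1)
  have hterm : ∀ k : ℕ, f ((k : ℝ) + 1) ≤ ∫ x in (k : ℝ)..((k + 1 : ℕ) : ℝ), f x := by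
    intro k
    have : ∫ x in (k : ℝ)..((k + 1 : ℕ) : ℝ), f ((k : ℝ) + 1) = f ((k : ℝ) + 1) := by simp
    rw [← this]
    refine intervalIntegral.integral_mono_on_of_le_Ioo (by push_cast; linarith) (by simp)
      (hii _ _ (by positivity) (by push_cast; linarith)) ?_
    intro x hx
    push_cast at hx
    have hk : (0:ℝ) ≤ k := by positivity
    have hx0 : 0 < x := lt_of_le_of_lt hk hx.1
    simp only [hf]
    apply mul_le_mul _ _ (Real.exp_pos _).le (by positivity)
    · exact Real.rpow_le_rpow_of_nonpos hx0 hx.2.le (by norm_num)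
    · apply Real.exp_le_exp.2; nlinarith [hx.2]
  calc ∑ k ∈ Finset.range N, f ((k : ℝ) + 1)
      ≤ ∑ k ∈ Finset.range N, ∫ x in (k : ℝ)..((k + 1 : ℕ) : ℝ), f x := Finset.sum_le_sum fun k _ => hterm k
    _ = ∫ x in ((0 : ℕ) : ℝ)..(N : ℝ), f x := by
        apply intervalIntegral.sum_integral_adjacent_intervals (a := fun k : ℕ => (k : ℝ))
        intro k _
        exact hii _ _ (by positivity) (by push_cast; linarith)
    _ ≤ ∫ x in Ioi 0, f x := by
        rw [intervalIntegral.integral_of_le (by simp)]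
        apply setIntegral_mono_set hIntg
        · filter_upwards [ae_restrict_mem measurableSet_Ioi] with x hx
          have : (0:ℝ) < x := hx
          simp only [hf, Pi.zero_apply]; positivity
        · apply Eventually.of_forall
          intro x hx
          have h1 := hx.1
          have h2 : (0:ℝ) < x := by simpa using h1
          exact h2
    _ = _ := hval

lemma cs_half (c y : ℝ) (hc : 0 < c) (hy : 0 < y) (γ : ℕ → ℝ) (N : ℕ) :
    (∑ k ∈ Finset.range N, γ k * Real.exp (-c * k * y)) ^ 2 ≤
      (Real.Gamma (1 / 2) * (c * y) ^ (-(1 / 2) : ℝ) * Real.exp (2 * c * y)) *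
      ∑ k ∈ Finset.range N, γ k ^ 2 * ((k : ℝ) + 1) ^ (1 / 2 : ℝ) * Real.exp (-c * (k + 1) * y) := by
  have h1 := Finset.sum_mul_sq_le_sq_mul_sq (Finset.range N)
    (fun k : ℕ => γ k * ((k : ℝ) + 1) ^ (1 / 4 : ℝ) * Real.exp (-c * k * y / 2))
    (fun k : ℕ => ((k : ℝ) + 1) ^ (-(1 / 4) : ℝ) * Real.exp (-c * k * y / 2))
  have e1 : ∀ k : ℕ, γ k * ((k : ℝ) + 1) ^ (1 / 4 : ℝ) * Real.exp (-c * k * y / 2) *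
      (((k : ℝ) + 1) ^ (-(1 / 4) : ℝ) * Real.exp (-c * k * y / 2)) = γ k * Real.exp (-c * k * y) := by
    intro k
    have hk : (0:ℝ) < (k:ℝ) + 1 := by positivity
    have a1 : ((k : ℝ) + 1) ^ (1 / 4 : ℝ) * ((k : ℝ) + 1) ^ (-(1 / 4) : ℝ) = 1 := by
      rw [← Real.rpow_add hk]; norm_num
    have a2 : Real.exp (-c * k * y / 2) * Real.exp (-c * k * y / 2) = Real.exp (-c * k * y) := by
      rw [← Real.exp_add]; ring_nf
    calc _ = γ k * (((k : ℝ) + 1) ^ (1 / 4 : ℝ) * ((k : ℝ) + 1) ^ (-(1 / 4) : ℝ)) *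
          (Real.exp (-c * k * y / 2) * Real.exp (-c * k * y / 2)) := by ring
      _ = _ := by rw [a1, a2]; ring
  have e2 : ∀ k : ℕ, (γ k * ((k : ℝ) + 1) ^ (1 / 4 : ℝ) * Real.exp (-c * k * y / 2)) ^ 2 =
      Real.exp (c * y) * (γ k ^ 2 * ((k : ℝ) + 1) ^ (1 / 2 : ℝ) * Real.exp (-c * (k + 1) * y)) := by
    intro k
    have hk : (0:ℝ) < (k:ℝ) + 1 := by positivity
    rw [mul_pow, mul_pow, ← Real.rpow_mul_natCast hk.le, ← Real.exp_nat_mul]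
    have : Real.exp (((2:ℕ):ℝ) * (-c * k * y / 2)) = Real.exp (c * y) * Real.exp (-c * (k + 1) * y) := by
      rw [← Real.exp_add]; congr 1; push_cast; ring
    rw [this]; norm_num; ring
  have e3 : ∀ k : ℕ, (((k : ℝ) + 1) ^ (-(1 / 4) : ℝ) * Real.exp (-c * k * y / 2)) ^ 2 =
      Real.exp (c * y) * (((k : ℝ) + 1) ^ (-(1 / 2) : ℝ) * Real.exp (-(c * y) * (k + 1))) := by
    intro k
    have hk : (0:ℝ) < (k:ℝ) + 1 := by positivity
    rw [mul_pow, ← Real.rpow_mul_natCast hk.le, ← Real.exp_nat_mul]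
    have : Real.exp (((2:ℕ):ℝ) * (-c * k * y / 2)) = Real.exp (c * y) * Real.exp (-(c * y) * (k + 1)) := by
      rw [← Real.exp_add]; congr 1; push_cast; ring
    rw [this]; norm_num; ring
  simp only [e1, e2, e3, ← Finset.mul_sum] at h1
  refine h1.trans ?_
  have h2 := sum_half (c * y) (by positivity) N
  have h3 : 0 ≤ ∑ k ∈ Finset.range N, γ k ^ 2 * ((k : ℝ) + 1) ^ (1 / 2 : ℝ) * Real.exp (-c * (k + 1) * y) :=
    Finset.sum_nonneg fun k _ => by positivity
  have e4 : Real.exp (2 * c * y) = Real.exp (c * y) * Real.exp (c * y) := by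
    rw [← Real.exp_add]; ring_nf
  rw [e4]
  calc _ = (Real.exp (c * y) * Real.exp (c * y) * ∑ k ∈ Finset.range N, γ k ^ 2 * ((k : ℝ) + 1) ^ (1 / 2 : ℝ) * Real.exp (-c * (k + 1) * y)) * ∑ k ∈ Finset.range N, ((k : ℝ) + 1) ^ (-(1 / 2) : ℝ) * Real.exp (-(c * y) * (k + 1)) := by ring
    _ ≤ (Real.exp (c * y) * Real.exp (c * y) * ∑ k ∈ Finset.range N, γ k ^ 2 * ((k : ℝ) + 1) ^ (1 / 2 : ℝ) * Real.exp (-c * (k + 1) * y)) * (Real.Gamma (1 / 2) * (c * y) ^ (-(1 / 2) : ℝ)) := by gcongr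
    _ = _ := by ring

lemma hilbert_ineq (α c : ℝ) (hα : 0 < α) (hc : 0 < c) : ∃ C : ℝ, 0 < C ∧ ∀ x : H2,
    ∫⁻ t in Ioc 0 Real.pi, ENNReal.ofReal (t ^ (α - 1) * (∑' k : ℕ, ‖x k‖ * Real.exp (-c * k * t ^ α)) ^ 2)
      ≤ ENNReal.ofReal (C * ‖x‖ ^ 2) := by
  have hG : 0 < Real.Gamma (1 / 2) := Real.Gamma_pos_of_pos (by norm_num)
  set K : ℝ := Real.Gamma (1 / 2) * c ^ (-(1 / 2) : ℝ) * Real.exp (2 * c * Real.pi ^ α) with hK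
  have hKpos : 0 < K := by positivity
  set K2 : ℝ := K * (c ^ (-(1 / 2) : ℝ) * (1 / α) * Real.Gamma (1 / 2)) with hK2
  have hK2pos : 0 < K2 := by positivity
  refine ⟨K2, hK2pos, fun x => ?_⟩
  set h : ℕ → ℝ → ℝ := fun k t => K * ‖x k‖ ^ 2 * ((k : ℝ) + 1) ^ (1 / 2 : ℝ) *
    (t ^ (α / 2 - 1) * Real.exp (-(c * (k + 1)) * t ^ α)) with hh
  have hpt : ∀ t ∈ Ioc 0 Real.pi,
      ENNReal.ofReal (t ^ (α - 1) * (∑' k : ℕ, ‖x k‖ * Real.exp (-c * k * t ^ α)) ^ 2) ≤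
      ∑' k, ENNReal.ofReal (h k t) := by
    intro t ht
    have ht0 : 0 < t := ht.1
    have hy : 0 < t ^ α := by positivity
    have hs : Summable (fun k : ℕ => ‖x k‖ * Real.exp (-c * k * t ^ α)) := by
      have := coeff_summable x (Real.exp (-c * t ^ α)) (Real.exp_pos _).le
        (by rw [Real.exp_lt_one_iff]; nlinarith)
      convert this using 2 with k
      rw [← Real.exp_nat_mul]; congr 2; ring
    have hl : Tendsto (fun N : ℕ => ENNReal.ofReal (t ^ (α - 1) *
        (∑ k ∈ Finset.range N, ‖x k‖ * Real.exp (-c * k * t ^ α)) ^ 2)) atTop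
        (nhds (ENNReal.ofReal (t ^ (α - 1) * (∑' k : ℕ, ‖x k‖ * Real.exp (-c * k * t ^ α)) ^ 2))) :=
      ENNReal.tendsto_ofReal ((hs.hasSum.tendsto_sum_nat.pow 2).const_mul _)
    refine le_of_tendsto' hl fun N => ?_
    refine le_trans ?_ (ENNReal.sum_le_tsum (Finset.range N))
    rw [← ENNReal.ofReal_sum_of_nonneg (fun k _ => by simp only [hh]; positivity)]
    apply ENNReal.ofReal_le_ofReal
    have := cs_half c (t ^ α) hc hy (fun k => ‖x k‖) N
    calc _ ≤ t ^ (α - 1) * ((Real.Gamma (1 / 2) * (c * t ^ α) ^ (-(1 / 2) : ℝ) * Real.exp (2 * c * t ^ α)) *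
      ∑ k ∈ Finset.range N, ‖x k‖ ^ 2 * ((k : ℝ) + 1) ^ (1 / 2 : ℝ) * Real.exp (-c * (k + 1) * t ^ α)) := by
          gcongr
      _ ≤ t ^ (α - 1) * ((Real.Gamma (1 / 2) * (c * t ^ α) ^ (-(1 / 2) : ℝ) * Real.exp (2 * c * Real.pi ^ α)) *
      ∑ k ∈ Finset.range N, ‖x k‖ ^ 2 * ((k : ℝ) + 1) ^ (1 / 2 : ℝ) * Real.exp (-c * (k + 1) * t ^ α)) := by
          have h3 : 0 ≤ ∑ k ∈ Finset.range N, ‖x k‖ ^ 2 * ((k : ℝ) + 1) ^ (1 / 2 : ℝ) * Real.exp (-c * (k + 1) * t ^ α) :=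
            Finset.sum_nonneg fun k _ => by positivity
          have h4 := ht.2
          gcongr
      _ = ∑ k ∈ Finset.range N, h k t := by
          rw [← mul_assoc, Finset.mul_sum]
          refine Finset.sum_congr rfl fun k _ => ?_
          simp only [hh, hK]
          have a1 : (c * t ^ α) ^ (-(1 / 2) : ℝ) = c ^ (-(1 / 2) : ℝ) * t ^ (-(α / 2)) := by
            rw [Real.mul_rpow hc.le hy.le, ← Real.rpow_mul ht0.le]; ring_nf
          have a2 : t ^ (α / 2 - 1) = t ^ (α - 1) * t ^ (-(α / 2)) := by
            rw [← Real.rpow_add ht0]; ring_nf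
          have a3 : -(c * ((k:ℝ) + 1)) * t ^ α = -c * (k + 1) * t ^ α := by ring
          rw [a1, a2, a3]; ring
  calc _ ≤ ∫⁻ t in Ioc 0 Real.pi, ∑' k, ENNReal.ofReal (h k t) := setLIntegral_mono' measurableSet_Ioc hpt
    _ = ∑' k, ∫⁻ t in Ioc 0 Real.pi, ENNReal.ofReal (h k t) := by
        apply lintegral_tsum
        intro k
        apply Measurable.aemeasurable
        simp only [hh]; fun_prop
    _ ≤ ∑' k, ENNReal.ofReal (K2 * ‖x k‖ ^ 2) := by
        apply ENNReal.tsum_le_tsum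
        intro k
        have hb : 0 < c * ((k:ℝ) + 1) := by positivity
        have hk : (0:ℝ) < (k:ℝ) + 1 := by positivity
        have hi := gamma_integrable (p := α) (q := α / 2 - 1) hα (by linarith) hb
        have hv := integral_rpow_mul_exp_neg_mul_rpow (p := α) (q := α / 2 - 1) hα (by linarith) hb
        calc _ ≤ ∫⁻ t in Ioi 0, ENNReal.ofReal (h k t) := lintegral_mono_set Ioc_subset_Ioi_self
          _ = ENNReal.ofReal (∫ t in Ioi 0, h k t) := by
              rw [ofReal_integral_eq_lintegral_ofReal]
              · exact hi.const_mul _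
              · filter_upwards [ae_restrict_mem measurableSet_Ioi] with t ht
                have : (0:ℝ) < t := ht
                simp only [hh, Pi.zero_apply]; positivity
          _ = _ := by
              congr 1
              simp only [hh]
              rw [integral_const_mul, hv]
              have a1 : (c * ((k:ℝ) + 1)) ^ (-(α / 2 - 1 + 1) / α) = c ^ (-(1 / 2) : ℝ) * ((k:ℝ) + 1) ^ (-(1 / 2) : ℝ) := by
                rw [← Real.mul_rpow hc.le hk.le]; congr 1; field_simp; ring
              have a2 : (α / 2 - 1 + 1) / α = 1 / 2 := by field_simp; ring
              have a3 : ((k : ℝ) + 1) ^ (1 / 2 : ℝ) * ((k : ℝ) + 1) ^ (-(1 / 2) : ℝ) = 1 := by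
                rw [← Real.rpow_add hk]; norm_num
              rw [a1, a2, hK2]
              linear_combination (K * ‖x k‖ ^ 2 * c ^ (-(1 / 2) : ℝ) * (1 / α) * Real.Gamma (1 / 2)) * a3
    _ = ENNReal.ofReal (K2 * ‖x‖ ^ 2) := by
        rw [← ENNReal.ofReal_tsum_of_nonneg (fun k => by positivity) ((h2_summable x).mul_left _),
          tsum_mul_left, h2_norm_sq]


lemma cosSum (φ : ℝ) (h0 : 0 ≤ φ) (h1 : φ ≤ 2 * Real.pi) :
    HasSum (fun n : ℕ => 1 / (n : ℝ) ^ 2 * Real.cos (n * φ))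
      (Real.pi ^ 2 / 6 - Real.pi * φ / 2 + φ ^ 2 / 4) := by
  have hpi := Real.pi_pos
  have h := hasSum_one_div_nat_pow_mul_cos (k := 1) one_ne_zero (x := φ / (2 * Real.pi))
    ⟨by positivity, by rw [div_le_one (by positivity)]; exact h1⟩
  have e1 : (Polynomial.map (algebraMap ℚ ℝ) (Polynomial.bernoulli (2 * 1))).eval (φ / (2 * Real.pi))
      = (φ / (2 * Real.pi)) ^ 2 - φ / (2 * Real.pi) + 1 / 6 := by
    simp only [Polynomial.bernoulli, Finset.sum_range_succ, Finset.sum_range_zero]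
    simp [bernoulli_one, bernoulli_two, Polynomial.map_monomial]
    ring
  rw [e1] at h
  convert h using 1
  · ext n
    congr 2
    field_simp
  · simp [Nat.factorial]
    field_simp
    ring

lemma logSer (q φ : ℝ) (h0 : 0 ≤ q) (h1 : q < 1) :
    HasSum (fun m : ℕ => q ^ m * Real.cos (m * φ) / m)
      (-(1 / 2) * Real.log (1 - 2 * q * Real.cos φ + q ^ 2)) := by
  set z : ℂ := q * Complex.exp (φ * I) with hz
  have hzn : ‖z‖ < 1 := by
    simp [hz, Complex.norm_exp_ofReal_mul_I, abs_of_nonneg h0, h1]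
  have h := Complex.hasSum_re (Complex.hasSum_taylorSeries_neg_log hzn)
  convert h using 1
  · ext m
    have : z ^ m / m = ((q ^ m / m : ℝ) : ℂ) * Complex.exp ((m * φ : ℝ) * I) := by
      rw [hz, mul_pow, ← Complex.exp_nat_mul]; push_cast; ring_nf
    rw [this, Complex.re_ofReal_mul, Complex.exp_ofReal_mul_I_re]; ring
  · rw [Complex.neg_re, Complex.log_re]
    have h2 : ‖1 - z‖ ^ 2 = 1 - 2 * q * Real.cos φ + q ^ 2 := by
      rw [← Complex.normSq_eq_norm_sq, Complex.normSq_apply]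
      have r1 : z.re = q * Real.cos φ := by
        rw [hz, Complex.re_ofReal_mul, Complex.exp_ofReal_mul_I_re]
      have r2 : z.im = q * Real.sin φ := by
        rw [hz, Complex.im_ofReal_mul, Complex.exp_ofReal_mul_I_im]
      simp only [Complex.sub_re, Complex.sub_im, Complex.one_re, Complex.one_im, r1, r2]
      nlinarith [Real.sin_sq_add_cos_sq φ]
    rw [← h2, Real.log_pow]; push_cast; ring

def gg (θ y : ℝ) : ℝ := 1 / 2 * Real.log ((Real.cosh y + Real.cos θ) / (Real.cosh y - Real.cos θ))

lemma cos_pos' {θ : ℝ} (h0 : 0 < θ) (h1 : θ < Real.pi / 2) : 0 < Real.cos θ := Real.cos_pos_of_mem_Ioo ⟨by linarith, h1⟩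
lemma cos_lt' {θ : ℝ} (h0 : 0 < θ) (h1 : θ < Real.pi / 2) : Real.cos θ < 1 := by
  have := Real.cos_lt_cos_of_nonneg_of_le_pi le_rfl (by linarith [Real.pi_pos]) h0
  simpa using this

lemma gg_cont {θ : ℝ} (h0 : 0 < θ) (h1 : θ < Real.pi / 2) : Continuous (gg θ) := by
  unfold gg
  have h2 := cos_pos' h0 h1
  have h3 := cos_lt' h0 h1
  have h4 : ∀ y, 0 < Real.cosh y - Real.cos θ := fun y => by linarith [Real.one_le_cosh y]
  have h5 : ∀ y, 0 < Real.cosh y + Real.cos θ := fun y => by linarith [Real.one_le_cosh y]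
  refine continuous_const.mul (Continuous.log ?_ ?_)
  · exact (Real.continuous_cosh.add continuous_const).div (Real.continuous_cosh.sub continuous_const)
      (fun y => (h4 y).ne')
  · intro y; exact (div_pos (h5 y) (h4 y)).ne'

lemma gg_even {θ : ℝ} (y : ℝ) : gg θ (-y) = gg θ y := by simp [gg]

lemma gg_anti {θ : ℝ} (h0 : 0 < θ) (h1 : θ < Real.pi / 2) {a b : ℝ} (ha : |a| ≤ |b|) : gg θ b ≤ gg θ a := by
  have h2 := cos_pos' h0 h1
  have h3 := cos_lt' h0 h1
  have h4 := Real.one_le_cosh a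
  have h5 : Real.cosh a ≤ Real.cosh b := Real.cosh_le_cosh.2 ha
  unfold gg
  have : (Real.cosh b + Real.cos θ) / (Real.cosh b - Real.cos θ) ≤
    (Real.cosh a + Real.cos θ) / (Real.cosh a - Real.cos θ) := by
    rw [div_le_div_iff₀ (by linarith) (by linarith)]
    nlinarith
  have hp : 0 < (Real.cosh b + Real.cos θ) / (Real.cosh b - Real.cos θ) :=
    div_pos (by linarith) (by linarith)
  have := Real.log_le_log hp this
  linarith

lemma gg_nonneg {θ : ℝ} (h0 : 0 < θ) (h1 : θ < Real.pi / 2) (y : ℝ) : 0 ≤ gg θ y := by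
  have h2 := cos_pos' h0 h1
  have h3 := cos_lt' h0 h1
  have h4 := Real.one_le_cosh y
  unfold gg
  have : 0 ≤ Real.log ((Real.cosh y + Real.cos θ) / (Real.cosh y - Real.cos θ)) := by
    apply Real.log_nonneg
    rw [le_div_iff₀ (by linarith)]
    linarith
  linarith

lemma gg_bound {θ : ℝ} (h0 : 0 < θ) (h1 : θ < Real.pi / 2) : ∃ C : ℝ, 0 < C ∧ ∀ y, gg θ y ≤ C * Real.exp (-|y|) := by
  have h2 := cos_pos' h0 h1
  have h3 := cos_lt' h0 h1
  set k := Real.cos θ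
  refine ⟨2 * k / (1 - k), div_pos (by linarith) (by linarith), fun y => ?_⟩
  have h4 := Real.one_le_cosh y
  have hp : 0 < (Real.cosh y + k) / (Real.cosh y - k) := div_pos (by linarith) (by linarith)
  have h5 := Real.log_le_sub_one_of_pos hp
  have h6 : (Real.cosh y + k) / (Real.cosh y - k) - 1 = 2 * k / (Real.cosh y - k) := by
    rw [div_sub_one (by linarith)]; ring_nf
  have h7 : Real.exp |y| / 2 ≤ Real.cosh y := by
    rw [← Real.cosh_abs, Real.cosh_eq]; linarith [Real.exp_pos (-|y|)]
  have h8 : (1 - k) * (Real.exp |y| / 2) ≤ Real.cosh y - k := by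
    nlinarith
  have h9 : 2 * k / (Real.cosh y - k) ≤ 2 * k / ((1 - k) * (Real.exp |y| / 2)) := by
    have : 0 < (1 - k) * (Real.exp |y| / 2) := mul_pos (by linarith) (by positivity)
    gcongr
  have h10 : 2 * k / ((1 - k) * (Real.exp |y| / 2)) = 2 * (2 * k / (1 - k) * Real.exp (-|y|)) := by
    rw [Real.exp_neg]
    have : 1 - k ≠ 0 := by linarith
    field_simp
  unfold gg
  change 1 / 2 * Real.log ((Real.cosh y + k) / (Real.cosh y - k)) ≤ _
  linarith

lemma gg_ser {θ : ℝ} (h0 : 0 < θ) (h1 : θ < Real.pi / 2) (y : ℝ) (hy : 0 < y) :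
    HasSum (fun m : ℕ => (Real.cos (m * θ) - Real.cos (m * (θ + Real.pi))) / m * Real.exp (-m * y)) (gg θ y) := by
  have h2 := cos_pos' h0 h1
  have h3 := cos_lt' h0 h1
  have h4 := Real.one_le_cosh y
  set q := Real.exp (-y) with hq
  have hq1 : q < 1 := by rw [hq, Real.exp_lt_one_iff]; linarith
  have hq0 : 0 < q := Real.exp_pos _
  have hs := (logSer q θ hq0.le hq1).sub (logSer q (θ + Real.pi) hq0.le hq1)
  have ef : (fun m : ℕ => (Real.cos (m * θ) - Real.cos (m * (θ + Real.pi))) / m * Real.exp (-m * y)) =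
      fun m : ℕ => q ^ m * Real.cos (m * θ) / m - q ^ m * Real.cos (m * (θ + Real.pi)) / m := by
    funext m
    have : Real.exp (-m * y) = q ^ m := by rw [hq, ← Real.exp_nat_mul]; ring_nf
    rw [this]; ring
  have ev : gg θ y = -(1 / 2) * Real.log (1 - 2 * q * Real.cos θ + q ^ 2) -
      -(1 / 2) * Real.log (1 - 2 * q * Real.cos (θ + Real.pi) + q ^ 2) := by
    rw [Real.cos_add_pi]
    have hc : Real.cosh y = (q⁻¹ + q) / 2 := by
      rw [Real.cosh_eq, hq, Real.exp_neg, inv_inv]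
    have e1 : 1 - 2 * q * Real.cos θ + q ^ 2 = 2 * q * (Real.cosh y - Real.cos θ) := by
      rw [hc]; field_simp; ring
    have e2 : 1 - 2 * q * (-Real.cos θ) + q ^ 2 = 2 * q * (Real.cosh y + Real.cos θ) := by
      rw [hc]; field_simp; ring
    have p1 : 0 < Real.cosh y - Real.cos θ := by linarith
    have p2 : 0 < Real.cosh y + Real.cos θ := by linarith
    rw [e1, e2, Real.log_mul (by positivity) p1.ne', Real.log_mul (by positivity) p2.ne']
    unfold gg
    rw [Real.log_div p2.ne' p1.ne']; ring
  rw [ef, ev]; exact hs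

lemma gg_integral_half {θ : ℝ} (h0 : 0 < θ) (h1 : θ < Real.pi / 2) : ∫ y in Ioi (0:ℝ), gg θ y = Real.pi ^ 2 / 4 - Real.pi * θ / 2 := by
  set c : ℕ → ℝ := fun m => Real.cos (m * θ) - Real.cos (m * (θ + Real.pi)) with hc
  set F : ℕ → ℝ → ℝ := fun m y => c m / m * Real.exp (-m * y) with hF
  have hval : ∀ m : ℕ, m ≠ 0 → ∫ y in Ioi (0:ℝ), Real.exp (-m * y) = 1 / m := by
    intro m hm
    have := integral_exp_mul_Ioi (a := -(m:ℝ)) (by simp; omega) 0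
    rw [this]; simp
  have hIntg0 : ∀ m : ℕ, m ≠ 0 → IntegrableOn (fun y : ℝ => Real.exp (-m * y)) (Ioi 0) := by
    intro m hm
    exact integrableOn_exp_mul_Ioi (a := -(m:ℝ)) (by simp; omega) 0
  have hIntg : ∀ m, IntegrableOn (F m) (Ioi 0) := by
    intro m
    rcases eq_or_ne m 0 with rfl | hm
    · simp [hF]
    · exact (hIntg0 m hm).const_mul _
  have hnorm : ∀ m, ∫ y in Ioi (0:ℝ), ‖F m y‖ = |c m| * (1 / (m:ℝ) ^ 2) := by
    intro m
    rcases eq_or_ne m 0 with rfl | hm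
    · simp [hF]
    · have : ∀ y, ‖F m y‖ = |c m| / m * Real.exp (-m * y) := by
        intro y
        simp [hF]
      simp only [this]
      rw [integral_const_mul, hval m hm]; field_simp
  have hval2 : ∀ m, ∫ y in Ioi (0:ℝ), F m y = 1 / (m:ℝ) ^ 2 * c m := by
    intro m
    rcases eq_or_ne m 0 with rfl | hm
    · simp [hF]
    · simp only [hF]
      rw [integral_const_mul, hval m hm]; field_simp
  have hsum : Summable fun m => ∫ y in Ioi (0:ℝ), ‖F m y‖ := by
    simp only [hnorm]
    have h2 : Summable fun m : ℕ => 2 * (1 / (m:ℝ) ^ 2) :=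
      (Real.summable_one_div_nat_pow.2 (by norm_num)).mul_left 2
    refine h2.of_nonneg_of_le (fun m => by positivity) fun m => ?_
    have : |c m| ≤ 2 := by
      have a1 := Real.abs_cos_le_one (m * θ)
      have a2 := Real.abs_cos_le_one (m * (θ + Real.pi))
      have := abs_sub (Real.cos (m * θ)) (Real.cos (m * (θ + Real.pi)))
      simp only [hc]; linarith
    gcongr
  have H := hasSum_integral_of_summable_integral_norm hIntg hsum
  have e : ∫ y in Ioi (0:ℝ), (∑' m, F m y) = ∫ y in Ioi (0:ℝ), gg θ y := by
    refine setIntegral_congr_fun measurableSet_Ioi fun y hy => ?_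
    exact (gg_ser h0 h1 y hy).tsum_eq
  rw [e] at H
  simp only [hval2] at H
  have H2 := (cosSum θ h0.le (by linarith [Real.pi_pos])).sub
    (cosSum (θ + Real.pi) (by linarith [Real.pi_pos]) (by linarith [Real.pi_pos]))
  have H3 : (fun m : ℕ => 1 / (m:ℝ) ^ 2 * c m) = fun m : ℕ => 1 / (m : ℝ) ^ 2 * Real.cos (m * θ) - 1 / (m : ℝ) ^ 2 * Real.cos (m * (θ + Real.pi)) := by
    ext m; simp only [hc]; ring
  rw [H3] at H
  rw [H.unique H2]; ring

lemma int_comp_abs {f : ℝ → ℝ} (hf0 : IntegrableOn f (Ioi 0)) : Integrable (fun x => f |x|) := by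
  have hf : IntegrableOn (fun x => f |x|) (Ioi 0) := by
    refine hf0.congr_fun (fun x hx => ?_) measurableSet_Ioi
    rw [abs_of_pos hx]
  have int_Iic : IntegrableOn (fun x ↦ f |x|) (Iic 0) := by
    rw [← Measure.map_neg_eq_self (volume : Measure ℝ)]
    let m : MeasurableEmbedding fun x : ℝ => -x := (Homeomorph.neg ℝ).measurableEmbedding
    rw [m.integrableOn_map_iff]
    simp_rw [Function.comp_def, abs_neg, neg_preimage, neg_Iic, neg_zero]
    exact Iff.mpr integrableOn_Ici_iff_integrableOn_Ioi hf
  have := int_Iic.union hf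
  rwa [Iic_union_Ioi, integrableOn_univ] at this

lemma gg_abs_integrable {θ : ℝ} (h0 : 0 < θ) (h1 : θ < Real.pi / 2) : Integrable (fun y => gg θ y) ∧ Integrable (fun y => y * gg θ y) := by
  obtain ⟨C, hC, hb⟩ := gg_bound h0 h1
  have hc := gg_cont h0 h1
  have base : Integrable (fun y : ℝ => (1 + |y|) * Real.exp (-|y|)) := by
    have h := int_comp_abs (f := fun y => (1 + y) * Real.exp (-y))
    refine h ?_
    have a1 : IntegrableOn (fun x : ℝ => x ^ (0:ℝ) * Real.exp (-1 * x ^ (1:ℝ))) (Ioi 0) :=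
      gamma_integrable one_pos (by norm_num) one_pos
    have a2 : IntegrableOn (fun x : ℝ => x ^ (1:ℝ) * Real.exp (-1 * x ^ (1:ℝ))) (Ioi 0) :=
      gamma_integrable one_pos (by norm_num) one_pos
    refine (a1.add a2).congr_fun (fun x hx => ?_) measurableSet_Ioi
    simp only [Pi.add_apply, Real.rpow_zero, Real.rpow_one, neg_one_mul]
    ring
  constructor
  · refine (base.const_mul C).mono' hc.aestronglyMeasurable (Eventually.of_forall fun y => ?_)
    rw [Real.norm_of_nonneg (gg_nonneg h0 h1 y)]
    have := hb y
    have e := Real.exp_pos (-|y|)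
    nlinarith [abs_nonneg y, mul_nonneg hC.le (mul_nonneg (abs_nonneg y) e.le)]
  · refine (base.const_mul C).mono' (continuous_id.mul hc).aestronglyMeasurable (Eventually.of_forall fun y => ?_)
    rw [norm_mul, Real.norm_of_nonneg (gg_nonneg h0 h1 y), Real.norm_eq_abs]
    have := mul_le_mul_of_nonneg_left (hb y) (abs_nonneg y)
    have e := Real.exp_pos (-|y|)
    nlinarith [mul_nonneg hC.le e.le]

lemma gg_full {θ : ℝ} (h0 : 0 < θ) (h1 : θ < Real.pi / 2) (D : ℝ) : ∫ y, (D - y) * gg θ y = D * (Real.pi ^ 2 / 2 - Real.pi * θ) := by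
  obtain ⟨i1, i2⟩ := gg_abs_integrable h0 h1
  have e1 : ∫ y, gg θ y = Real.pi ^ 2 / 2 - Real.pi * θ := by
    have := integral_comp_abs (f := gg θ)
    have e : ∀ y, gg θ |y| = gg θ y := by
      intro y; rcases abs_choice y with h | h <;> rw [h]
      exact gg_even y
    simp only [e] at this
    rw [this, gg_integral_half h0 h1]; ring
  have e2 : ∫ y, y * gg θ y = 0 := by
    have := integral_neg_eq_self (fun y => y * gg θ y) volume
    simp only [gg_even, neg_mul, integral_neg] at this
    linarith
  simp only [sub_mul]
  rw [integral_sub (i1.const_mul D) i2, integral_const_mul, e1, e2, sub_zero]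


def VV (θ y : ℝ) : ℝ := 2 * gg θ (min y 0) - gg θ y

lemma gmin_mono {θ : ℝ} (h0 : 0 < θ) (h1 : θ < Real.pi / 2) {a b : ℝ} (h : a ≤ b) :
    gg θ (min a 0) ≤ gg θ (min b 0) := by
  apply gg_anti h0 h1
  rw [abs_of_nonpos (min_le_right _ _), abs_of_nonpos (min_le_right _ _)]
  have := min_le_min_right (0:ℝ) h
  linarith

lemma VV_of_nonpos {θ y : ℝ} (h : y ≤ 0) : VV θ y = gg θ y := by
  simp [VV, min_eq_left h]; ring
lemma VV_of_nonneg {θ y : ℝ} (h : 0 ≤ y) : VV θ y = 2 * gg θ 0 - gg θ y := by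
  simp [VV, min_eq_right h]

lemma VV_mono {θ : ℝ} (h0 : 0 < θ) (h1 : θ < Real.pi / 2) {a b : ℝ} (h : a ≤ b) : VV θ a ≤ VV θ b := by
  have z : ∀ y, gg θ y ≤ gg θ 0 := fun y => gg_anti h0 h1 (by simp)
  rcases le_total a 0 with ha | ha
  · rcases le_total b 0 with hb | hb
    · rw [VV_of_nonpos ha, VV_of_nonpos hb]
      apply gg_anti h0 h1
      rw [abs_of_nonpos ha, abs_of_nonpos hb]; linarith
    · rw [VV_of_nonpos ha, VV_of_nonneg hb]
      linarith [z a, z b]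
  · have hb := ha.trans h
    rw [VV_of_nonneg ha, VV_of_nonneg hb]
    have : gg θ b ≤ gg θ a := by
      apply gg_anti h0 h1
      rwa [abs_of_nonneg ha, abs_of_nonneg hb]
    linarith

lemma VV_nonneg {θ : ℝ} (h0 : 0 < θ) (h1 : θ < Real.pi / 2) (y : ℝ) : 0 ≤ VV θ y := by
  have z : ∀ y, gg θ y ≤ gg θ 0 := fun y => gg_anti h0 h1 (by simp)
  rcases le_total y 0 with ha | ha
  · rw [VV_of_nonpos ha]; exact gg_nonneg h0 h1 y
  · rw [VV_of_nonneg ha]; linarith [z y, gg_nonneg h0 h1 y]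
lemma VV_le {θ : ℝ} (h0 : 0 < θ) (h1 : θ < Real.pi / 2) (y : ℝ) : VV θ y ≤ 2 * gg θ 0 := by
  have z : ∀ y, gg θ y ≤ gg θ 0 := fun y => gg_anti h0 h1 (by simp)
  rcases le_total y 0 with ha | ha
  · rw [VV_of_nonpos ha]; linarith [z y, gg_nonneg h0 h1 y]
  · rw [VV_of_nonneg ha]; linarith [z y, gg_nonneg h0 h1 y]

lemma sum_ge_int {θ : ℝ} (h0 : 0 < θ) (h1 : θ < Real.pi / 2) (c0 : ℝ) (hc : 0 < c0) (n : ℕ) (x : ℝ) :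
    ∫ s in (0:ℝ)..(c0 * √n), 2 / c0 ^ 2 * (c0 * √n - s) * gg θ (x - s) ≤
      ∑ j ∈ Finset.range n, gg θ (x - (c0 * √n - c0 * √((j+1 : ℕ) : ℝ))) + 2 * gg θ 0 := by
  set S := c0 * √n with hS
  set s : ℕ → ℝ := fun j => S - c0 * √(j:ℝ) with hs
  have hcont := gg_cont h0 h1
  have hF : Continuous fun t => 2 / c0 ^ 2 * (S - t) * gg θ (x - t) := by fun_prop
  have key : ∀ j : ℕ, ∫ t in (s (j+1))..(s j), 2 / c0 ^ 2 * (S - t) * gg θ (x - t) ≤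
      gg θ (x - s (j+1)) + (VV θ (x - s (j+1)) - VV θ (x - s j)) := by
    intro j
    have hle : s (j+1) ≤ s j := by
      simp only [hs]
      have : √(j:ℝ) ≤ √((j+1 : ℕ):ℝ) := Real.sqrt_le_sqrt (by push_cast; linarith)
      nlinarith
    have hsS : s j ≤ S := by
      simp only [hs]
      have : 0 ≤ c0 * √(j:ℝ) := by positivity
      linarith
    set K := gg θ (x - s (j+1)) + (VV θ (x - s (j+1)) - VV θ (x - s j)) with hK
    have e1 : ∫ t in (s (j+1))..(s j), 2 / c0 ^ 2 * (S - t) = 1 := by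
      have : ∀ t ∈ uIcc (s (j+1)) (s j), HasDerivAt (fun t => -(1 / c0 ^ 2) * (S - t) ^ 2) (2 / c0 ^ 2 * (S - t)) t := by
        intro t _
        have := (((hasDerivAt_id t).const_sub S).pow 2).const_mul (-(1 / c0 ^ 2))
        refine (this.congr_deriv ?_)
        simp only [id]; ring
      rw [intervalIntegral.integral_eq_sub_of_hasDerivAt this (by apply Continuous.intervalIntegrable; fun_prop)]
      simp only [hs]
      have a1 : (S - (S - c0 * √(j:ℝ))) ^ 2 = c0 ^ 2 * j := by
        have := Real.sq_sqrt (Nat.cast_nonneg (α := ℝ) j)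
        linear_combination c0 ^ 2 * this
      have a2 : (S - (S - c0 * √((j+1 : ℕ):ℝ))) ^ 2 = c0 ^ 2 * (j + 1) := by
        have := Real.sq_sqrt (Nat.cast_nonneg (α := ℝ) (j+1))
        push_cast at this ⊢
        linear_combination c0 ^ 2 * this
      rw [a1, a2]
      field_simp; ring
    calc ∫ t in (s (j+1))..(s j), 2 / c0 ^ 2 * (S - t) * gg θ (x - t)
        ≤ ∫ t in (s (j+1))..(s j), 2 / c0 ^ 2 * (S - t) * K := by
          apply intervalIntegral.integral_mono_on hle (hF.intervalIntegrable _ _)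
          · apply Continuous.intervalIntegrable; fun_prop
          · intro t ht
            apply mul_le_mul_of_nonneg_left
            · have b1 : gg θ (min (x - t) 0) ≤ gg θ (min (x - s (j+1)) 0) := gmin_mono h0 h1 (by linarith [ht.1])
              have b2 : VV θ (x - s j) ≤ VV θ (x - t) := VV_mono h0 h1 (by linarith [ht.2])
              have b3 : ∀ y, gg θ y + VV θ y = 2 * gg θ (min y 0) := fun y => by simp [VV]
              linarith [b3 (x - t), b3 (x - s (j+1))]
            · have : 0 ≤ S - t := by linarith [ht.2]
              positivity
      _ = K := by rw [intervalIntegral.integral_mul_const, e1, one_mul]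
  have hsum := intervalIntegral.sum_integral_adjacent_intervals (a := s) (n := n) (f := fun t => 2 / c0 ^ 2 * (S - t) * gg θ (x - t)) (μ := volume) (fun k _ => hF.intervalIntegrable _ _)
  have z0 : s 0 = S := by simp [hs]
  have zn : s n = 0 := by simp [hs, hS]
  rw [z0, zn, intervalIntegral.integral_symm] at hsum
  have h3 : ∫ s in (0:ℝ)..S, 2 / c0 ^ 2 * (S - s) * gg θ (x - s) = ∑ j ∈ Finset.range n, ∫ t in (s (j+1))..(s j), 2 / c0 ^ 2 * (S - t) * gg θ (x - t) := by
    rw [← neg_neg (∫ s in (0:ℝ)..S, 2 / c0 ^ 2 * (S - s) * gg θ (x - s)), ← hsum, ← Finset.sum_neg_distrib]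
    refine Finset.sum_congr rfl fun j _ => ?_
    rw [intervalIntegral.integral_symm, neg_neg]
  rw [h3]
  refine (Finset.sum_le_sum fun j _ => key j).trans ?_
  rw [Finset.sum_add_distrib, Finset.sum_range_sub (fun j => VV θ (x - s j)), zn, z0]
  have := VV_nonneg h0 h1 (x - S)
  have := VV_le h0 h1 (x - 0)
  gcongr
  linarith

lemma int_ge {θ : ℝ} (h0 : 0 < θ) (h1 : θ < Real.pi / 2) : ∃ K : ℝ, 0 < K ∧ ∀ S x : ℝ, 0 ≤ S → 0 ≤ x → 
    (S - x) * (Real.pi ^ 2 / 2 - Real.pi * θ) - K * (S + 1) * Real.exp (-x) ≤ ∫ s in (0:ℝ)..S, (S - s) * gg θ (x - s) := by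
  obtain ⟨C, hC, hb⟩ := gg_bound h0 h1
  obtain ⟨i1, i2⟩ := gg_abs_integrable h0 h1
  refine ⟨4 * C, by linarith, fun S x hS hx => ?_⟩
  set D := S - x with hD
  have hi : Integrable (fun y => (D - y) * gg θ y) := by
    have := (i1.const_mul D).sub i2
    refine this.congr (Eventually.of_forall fun y => ?_)
    simp; ring
  have e1 : ∫ s in (0:ℝ)..S, (S - s) * gg θ (x - s) = ∫ y in (-x)..D, (D - y) * gg θ y := by
    have := intervalIntegral.integral_comp_sub_right (a := 0) (b := S) (fun y => (D - y) * gg θ y) x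
    rw [zero_sub] at this
    rw [← this]
    refine intervalIntegral.integral_congr fun s _ => ?_
    simp only [hD]
    rw [← gg_even (s - x)]
    congr 1
    · ring
    · congr 1; ring
  have hDx : -x ≤ D := by linarith
  rw [e1, ← gg_full h0 h1 D, intervalIntegral.integral_of_le hDx]
  have e2 : ∫ y, (D - y) * gg θ y = (∫ y in Iic (-x), (D - y) * gg θ y) + ((∫ y in Ioc (-x) D, (D - y) * gg θ y) + ∫ y in Ioi D, (D - y) * gg θ y) := by
    rw [← setIntegral_union (Ioc_disjoint_Ioi le_rfl) measurableSet_Ioi hi.integrableOn hi.integrableOn,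
      Ioc_union_Ioi_eq_Ioi hDx, ← setIntegral_union (Iic_disjoint_Ioi le_rfl) measurableSet_Ioi hi.integrableOn hi.integrableOn, Iic_union_Ioi, setIntegral_univ]
  have e3 : ∫ y in Ioi D, (D - y) * gg θ y ≤ 0 := by
    refine setIntegral_nonpos measurableSet_Ioi fun y hy => ?_
    have : D < y := hy
    have := gg_nonneg h0 h1 y
    nlinarith
  have e4 : ∫ y in Iic (-x), (D - y) * gg θ y ≤ 4 * C * (S + 1) * Real.exp (-x) := by
    have j1 : IntegrableOn (fun y : ℝ => Real.exp (1 * y)) (Iic (-x)) := integrableOn_exp_mul_Iic one_pos _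
    have j2 : IntegrableOn (fun y : ℝ => Real.exp ((1/2) * y)) (Iic (-x)) := integrableOn_exp_mul_Iic (by norm_num) _
    have j3 := (j1.const_mul (C * S)).add (j2.const_mul (C * 2 * Real.exp (-x / 2)))
    calc _ ≤ ∫ y in Iic (-x), (C * S * Real.exp (1 * y) + C * 2 * Real.exp (-x / 2) * Real.exp ((1/2) * y)) := by
          refine setIntegral_mono_on hi.integrableOn j3 measurableSet_Iic fun y hy => ?_
          have hy' : y ≤ -x := hy
          have g1 := hb y
          rw [abs_of_nonpos (by linarith), neg_neg] at g1
          have g2 : -x - y ≤ 2 * Real.exp ((-x - y) / 2) := by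
            have := Real.add_one_le_exp ((-x - y) / 2); linarith
          have g3 : Real.exp (-x / 2) * Real.exp ((1/2) * y) = Real.exp ((-x - y) / 2) * Real.exp y := by
            rw [← Real.exp_add, ← Real.exp_add]; congr 1; ring
          rw [mul_assoc (C * 2), g3, one_mul]
          calc (D - y) * gg θ y ≤ (D - y) * (C * Real.exp y) := mul_le_mul_of_nonneg_left g1 (by linarith)
            _ ≤ (S + 2 * Real.exp ((-x - y) / 2)) * (C * Real.exp y) := by
              apply mul_le_mul_of_nonneg_right _ (by positivity)
              linarith
            _ = _ := by ring
      _ = C * S * Real.exp (-x) + C * 4 * Real.exp (-x) := by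
          rw [integral_add (j1.const_mul (C * S)) (j2.const_mul (C * 2 * Real.exp (-x / 2))), integral_const_mul, integral_const_mul, integral_exp_mul_Iic one_pos, integral_exp_mul_Iic (by norm_num)]
          have : Real.exp (-x / 2) * Real.exp ((1/2) * (-x)) = Real.exp (-x) := by
            rw [← Real.exp_add]; congr 1; ring
          rw [one_mul]
          linear_combination (4 * C) * this
      _ ≤ _ := by
          have : 0 ≤ C * S * Real.exp (-x) := by positivity
          nlinarith
  linarith

lemma sum_est {α : ℝ} (hα₀ : 0 < α) (hα₁ : α < 1) : ∃ K1 K2 : ℝ, 0 < K1 ∧ ∀ (n : ℕ) (x : ℝ), 0 ≤ x →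
    (1 - α) / (2 * α) * (Real.pi * √(2 * α) * √n - x) - K1 * (√n + 1) * Real.exp (-x) - K2 ≤
      ∑ j ∈ Finset.range n, gg (α * Real.pi / 2) (x - (Real.pi * √(2 * α) * √n - Real.pi * √(2 * α) * √((j+1 : ℕ) : ℝ))) := by
  have hpi := Real.pi_pos
  have h0 : 0 < α * Real.pi / 2 := by positivity
  have h1 : α * Real.pi / 2 < Real.pi / 2 := by nlinarith
  set θ := α * Real.pi / 2 with hθ
  obtain ⟨K, hK, H⟩ := int_ge h0 h1
  set c0 := Real.pi * √(2 * α) with hc0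
  have hc : 0 < c0 := by positivity
  have hsq : c0 ^ 2 = Real.pi ^ 2 * (2 * α) := by
    rw [hc0, mul_pow, Real.sq_sqrt (by positivity)]
  refine ⟨2 / c0 ^ 2 * (K * (c0 + 1)), 2 * gg θ 0, by positivity, fun n x hx => ?_⟩
  have a := sum_ge_int h0 h1 c0 hc n x
  have b := H (c0 * √n) x (by positivity) hx
  simp only [mul_assoc] at a
  rw [intervalIntegral.integral_const_mul] at a
  have b' := mul_le_mul_of_nonneg_left b (show 0 ≤ 2 / c0 ^ 2 by positivity)
  have e : 2 / c0 ^ 2 * ((c0 * √n - x) * (Real.pi ^ 2 / 2 - Real.pi * θ)) = (1 - α) / (2 * α) * (c0 * √n - x) := by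
    rw [hsq, hθ]; field_simp
  have f : K * (c0 * √n + 1) * Real.exp (-x) ≤ K * (c0 + 1) * (√n + 1) * Real.exp (-x) := by
    have : 0 ≤ √(n:ℝ) := Real.sqrt_nonneg _
    have h2 : c0 * √n + 1 ≤ (c0 + 1) * (√n + 1) := by nlinarith
    rw [mul_assoc K (c0 + 1)]
    gcongr
  have f' := mul_le_mul_of_nonneg_left f (show 0 ≤ 2 / c0 ^ 2 by positivity)
  rw [mul_sub, e] at b'
  have g : 2 / c0 ^ 2 * (K * (c0 + 1)) * (√n + 1) * Real.exp (-x) = 2 / c0 ^ 2 * (K * (c0 + 1) * (√n + 1) * Real.exp (-x)) := by ring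
  rw [g]
  linarith


lemma le_of_sq_le_sq' {a b : ℝ} (h : a ^ 2 ≤ b ^ 2) (hb : 0 ≤ b) : a ≤ b :=
  (le_abs_self a).trans (abs_le_of_sq_le_sq h hb)

lemma fac_bound {θ : ℝ} (h0 : 0 < θ) (h1 : θ < Real.pi / 2) (v : ℂ) (hv : v ≠ 0)
    (hre : Real.cos θ * ‖v‖ ≤ v.re) (s : ℝ) :
    ‖((Real.exp (-s) : ℝ) - v) / ((Real.exp (-s) : ℝ) + v)‖ ≤ Real.exp (-gg θ (-Real.log ‖v‖ - s)) := by
  have h2 := cos_pos' h0 h1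
  have h3 := cos_lt' h0 h1
  set t := Real.exp (-s) with ht
  have htp : 0 < t := Real.exp_pos _
  set m := ‖v‖ with hm
  have hmp : 0 < m := norm_pos_iff.2 hv
  set k := Real.cos θ with hk
  have hch : Real.cosh (-Real.log m - s) = (t ^ 2 + m ^ 2) / (2 * t * m) := by
    rw [Real.cosh_eq]
    have e1 : Real.exp (-Real.log m - s) = t / m := by
      rw [sub_eq_add_neg, Real.exp_add, Real.exp_neg, Real.exp_log hmp, ← ht]; field_simp
    have e2 : Real.exp (-(-Real.log m - s)) = m / t := by
      rw [Real.exp_neg, e1]; field_simp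
    rw [e1, e2]; field_simp
  have hpos : 0 < t ^ 2 + m ^ 2 - 2 * t * m * k := by
    nlinarith [sq_nonneg (t - m), mul_pos htp hmp]
  have hpos2 : 0 < t ^ 2 + m ^ 2 + 2 * t * m * k := by positivity
  have hgg : Real.exp (-gg θ (-Real.log m - s)) ^ 2 = (t ^ 2 + m ^ 2 - 2 * t * m * k) / (t ^ 2 + m ^ 2 + 2 * t * m * k) := by
    rw [← Real.exp_nat_mul]
    unfold gg
    rw [hch]
    have : ((t ^ 2 + m ^ 2) / (2 * t * m) + k) / ((t ^ 2 + m ^ 2) / (2 * t * m) - k) = (t ^ 2 + m ^ 2 + 2 * t * m * k) / (t ^ 2 + m ^ 2 - 2 * t * m * k) := by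
      have : (t ^ 2 + m ^ 2) / (2 * t * m) - k = (t ^ 2 + m ^ 2 - 2 * t * m * k) / (2 * t * m) := by field_simp
      rw [this]
      have : (t ^ 2 + m ^ 2) / (2 * t * m) + k = (t ^ 2 + m ^ 2 + 2 * t * m * k) / (2 * t * m) := by field_simp
      rw [this]
      field_simp
    rw [this]
    have e : ((2:ℕ):ℝ) * -(1 / 2 * Real.log ((t ^ 2 + m ^ 2 + 2 * t * m * k) / (t ^ 2 + m ^ 2 - 2 * t * m * k))) = -Real.log ((t ^ 2 + m ^ 2 + 2 * t * m * k) / (t ^ 2 + m ^ 2 - 2 * t * m * k)) := by push_cast; ring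
    rw [e, Real.exp_neg, Real.exp_log (by positivity), inv_div]
  refine le_of_sq_le_sq' ?_ (Real.exp_pos _).le
  rw [hgg, norm_div, div_pow]
  have hmsq : v.re ^ 2 + v.im ^ 2 = m ^ 2 := by
    rw [hm, ← Complex.normSq_eq_norm_sq, Complex.normSq_apply]; ring
  have n1 : ‖(t:ℂ) - v‖ ^ 2 = t ^ 2 + m ^ 2 - 2 * t * v.re := by
    rw [← Complex.normSq_eq_norm_sq, Complex.normSq_apply]
    simp; nlinarith
  have n2 : ‖(t:ℂ) + v‖ ^ 2 = t ^ 2 + m ^ 2 + 2 * t * v.re := by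
    rw [← Complex.normSq_eq_norm_sq, Complex.normSq_apply]
    simp; nlinarith
  have hvre : 0 < v.re := lt_of_lt_of_le (by positivity) hre
  rw [n1, n2, div_le_div_iff₀ (by positivity) hpos2]
  have : 0 ≤ t * (v.re - k * m) := mul_nonneg htp.le (by linarith)
  nlinarith [mul_nonneg this (show 0 ≤ t ^ 2 + m ^ 2 by positivity)]

/-- geometry of the symbol -/
lemma map_geo {α : ℝ} (hα₀ : 0 < α) (hα₁ : α < 1) (z : ℂ) (hz : ‖z‖ < 1) :
    ∃ v : ℂ, v ≠ 0 ∧ ‖v‖ ≤ 1 ∧ ‖1 - z‖ ^ α / 4 ≤ ‖v‖ ∧ Real.cos (α * Real.pi / 2) * ‖v‖ ≤ v.re ∧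
      1 + v ≠ 0 ∧ (1 + Complex.exp ((α : ℂ) * Complex.log (1 - z)))⁻¹ = (1 - v) / (1 + v) ∧
      0 < ‖1 - z‖ := by
  have hpi := Real.pi_pos
  have h0 : 0 < α * Real.pi / 2 := by positivity
  have h1 : α * Real.pi / 2 < Real.pi / 2 := by nlinarith
  set w := 1 - z with hw
  have hwre : 0 < w.re := by
    have := (Complex.re_le_norm z)
    simp [hw]; linarith
  have hw0 : w ≠ 0 := by intro h; simp [h] at hwre
  have hwp : 0 < ‖w‖ := norm_pos_iff.2 hw0
  have hw2 : ‖w‖ ≤ 2 := by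
    have := norm_sub_le (1:ℂ) z
    rw [norm_one] at this; linarith
  set u := Complex.exp ((α : ℂ) * Complex.log w) with hu
  have hre : ((α : ℂ) * Complex.log w).re = α * Real.log ‖w‖ := by
    rw [Complex.re_ofReal_mul, Complex.log_re]
  have him : ((α : ℂ) * Complex.log w).im = α * Complex.arg w := by
    rw [Complex.im_ofReal_mul, Complex.log_im]
  have hun : ‖u‖ = ‖w‖ ^ α := by
    rw [hu, Complex.norm_exp, hre, Real.rpow_def_of_pos hwp, mul_comm]
  have hun' : ‖u‖ = Real.exp (α * Real.log ‖w‖) := by rw [hu, Complex.norm_exp, hre]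
  have harg : |Complex.arg w| ≤ Real.pi / 2 := Complex.abs_arg_le_pi_div_two_iff.2 hwre.le
  have hure : Real.cos (α * Real.pi / 2) * ‖u‖ ≤ u.re := by
    have e : u.re = ‖u‖ * Real.cos (α * Complex.arg w) := by
      rw [hun', hu, Complex.exp_re, hre, him]
    rw [e, mul_comm, ← Real.cos_abs (α * Complex.arg w)]
    apply mul_le_mul_of_nonneg_left _ (norm_nonneg _)
    apply Real.cos_le_cos_of_nonneg_of_le_pi (abs_nonneg _) (by linarith)
    rw [abs_mul, abs_of_pos hα₀]
    nlinarith
  have hu0 : u ≠ 0 := Complex.exp_ne_zero _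
  have hup : 0 < ‖u‖ := norm_pos_iff.2 hu0
  have hu2 : ‖u‖ ≤ 2 := by
    rw [hun]
    calc ‖w‖ ^ α ≤ 2 ^ α := Real.rpow_le_rpow hwp.le hw2 hα₀.le
      _ ≤ 2 ^ (1:ℝ) := Real.rpow_le_rpow_of_exponent_le (by norm_num) hα₁.le
      _ = 2 := by norm_num
  have hc := cos_pos' h0 h1
  have hc1 := cos_lt' h0 h1
  set k := Real.cos (α * Real.pi / 2) with hk
  have hurep : 0 < u.re := lt_of_lt_of_le (by positivity) hure
  have h2u : 2 + u ≠ 0 := by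
    intro h
    have := congrArg Complex.re h
    simp at this; linarith
  have h1u : 1 + u ≠ 0 := by
    intro h
    have := congrArg Complex.re h
    simp at this; linarith
  have husq : u.re ^ 2 + u.im ^ 2 = ‖u‖ ^ 2 := by
    rw [← Complex.normSq_eq_norm_sq, Complex.normSq_apply]; ring
  have n2 : ‖2 + u‖ ^ 2 = 4 + ‖u‖ ^ 2 + 4 * u.re := by
    rw [← husq, ← Complex.normSq_eq_norm_sq, Complex.normSq_apply]
    simp; nlinarith
  have h2p : 0 < ‖2 + u‖ := norm_pos_iff.2 h2u
  have h2le : ‖2 + u‖ ≤ 2 + ‖u‖ := by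
    have := norm_add_le (2:ℂ) u
    simpa using this
  refine ⟨u / (2 + u), div_ne_zero hu0 h2u, ?_, ?_, ?_, ?_, ?_, hwp⟩
  · rw [norm_div, div_le_one h2p]
    refine le_of_sq_le_sq' ?_ h2p.le
    rw [n2]; linarith
  · rw [norm_div, ← hun]
    gcongr
    linarith
  · rw [norm_div]
    have e : (u / (2 + u)).re = (2 * u.re + ‖u‖ ^ 2) / ‖2 + u‖ ^ 2 := by
      rw [Complex.div_re, Complex.normSq_eq_norm_sq, ← husq]
      simp; ring
    rw [e, ← mul_div_assoc, div_le_div_iff₀ h2p (by positivity)]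
    have a1 : k * ‖u‖ * (2 + ‖u‖) ≤ 2 * u.re + ‖u‖ ^ 2 := by nlinarith [sq_nonneg ‖u‖]
    calc k * ‖u‖ * ‖2 + u‖ ^ 2 = (k * ‖u‖ * ‖2 + u‖) * ‖2 + u‖ := by ring
      _ ≤ (k * ‖u‖ * (2 + ‖u‖)) * ‖2 + u‖ := by gcongr
      _ ≤ _ := by gcongr
  · have : 1 + u / (2 + u) = 2 * (1 + u) / (2 + u) := by field_simp; ring
    rw [this]
    exact div_ne_zero (mul_ne_zero two_ne_zero h1u) h2u
  · have : 1 + u / (2 + u) = 2 * (1 + u) / (2 + u) := by field_simp; ring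
    rw [this]
    have : 1 - u / (2 + u) = 2 / (2 + u) := by field_simp; ring
    rw [this]
    field_simp

lemma phi_norm {k : ℝ} (v : ℂ) (hv1 : ‖v‖ ≤ 1) (h1v : 1 + v ≠ 0) (hre : k * ‖v‖ ≤ v.re) (hk : 0 ≤ k) :
    ‖(1 - v) / (1 + v)‖ ≤ Real.exp (-(k * ‖v‖ / 2)) := by
  refine le_of_sq_le_sq' ?_ (Real.exp_pos _).le
  have hvsq : v.re ^ 2 + v.im ^ 2 = ‖v‖ ^ 2 := by
    rw [← Complex.normSq_eq_norm_sq, Complex.normSq_apply]; ring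
  have n1 : ‖1 - v‖ ^ 2 = 1 + ‖v‖ ^ 2 - 2 * v.re := by
    rw [← hvsq, ← Complex.normSq_eq_norm_sq, Complex.normSq_apply]
    simp; nlinarith
  have n2 : ‖1 + v‖ ^ 2 = 1 + ‖v‖ ^ 2 + 2 * v.re := by
    rw [← hvsq, ← Complex.normSq_eq_norm_sq, Complex.normSq_apply]
    simp; nlinarith
  have hp : 0 < ‖1 + v‖ := norm_pos_iff.2 h1v
  have hre0 : 0 ≤ v.re := le_trans (by positivity) hre
  have hre1 : v.re ≤ 1 := (Complex.re_le_norm v).trans hv1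
  rw [norm_div, div_pow, n1, n2, ← Real.exp_nat_mul]
  have e : Real.exp (-v.re) ≤ Real.exp (((2:ℕ):ℝ) * -(k * ‖v‖ / 2)) := by
    apply Real.exp_le_exp.2; push_cast; linarith
  refine le_trans ?_ e
  have := Real.add_one_le_exp (-v.re)
  refine le_trans ?_ this
  rw [div_le_iff₀ (by rw [← n2]; positivity)]
  have q : ‖v‖ ^ 2 ≤ 1 := pow_le_one₀ (norm_nonneg v) hv1
  nlinarith [mul_nonneg hre0 (show 0 ≤ 4 - (1 + ‖v‖ ^ 2 + 2 * v.re) by linarith)]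


def rj (s : ℝ) : ℂ := (((1 - Real.exp (-s)) / (1 + Real.exp (-s)) : ℝ) : ℂ)

lemma rj_norm (s : ℝ) : ‖rj s‖ < 1 := by
  have := Real.exp_pos (-s)
  rw [rj, Complex.norm_real, Real.norm_eq_abs, abs_lt]
  constructor
  · rw [lt_div_iff₀ (by positivity)]; linarith
  · rw [div_lt_iff₀ (by positivity)]; linarith

lemma rj_fac (s : ℝ) (v : ℂ) (h1v : 1 + v ≠ 0) :
    ((1 - v) / (1 + v) - rj s) / (1 - (starRingEnd ℂ (rj s)) * ((1 - v) / (1 + v))) =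
      ((Real.exp (-s) : ℝ) - v) / ((Real.exp (-s) : ℝ) + v) := by
  have hp := Real.exp_pos (-s)
  rw [rj, Complex.conj_ofReal]
  set t := Real.exp (-s)
  have h1t : (1 + t : ℂ) ≠ 0 := by
    have : (1 + t : ℝ) ≠ 0 := by positivity
    exact_mod_cast this
  push_cast
  have e1 : (1 - v) / (1 + v) - (1 - (t:ℂ)) / (1 + t) = (t - v) * (2 / ((1 + v) * (1 + t))) := by
    field_simp; ring
  have e2 : 1 - (1 - (t:ℂ)) / (1 + t) * ((1 - v) / (1 + v)) = (t + v) * (2 / ((1 + v) * (1 + t))) := by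
    field_simp; ring
  rw [e1, e2, mul_div_mul_right _ _ (div_ne_zero two_ne_zero (mul_ne_zero h1v h1t))]

def zl (α : ℝ) (n p : ℕ) : List ℂ :=
  (Finset.range n).toList.map (fun j => rj (Real.pi * √(2 * α) * √n - Real.pi * √(2 * α) * √((j+1 : ℕ) : ℝ))) ++ List.replicate p 0

lemma zl_len (α : ℝ) (n p : ℕ) : (zl α n p).length = n + p := by simp [zl]
lemma zl_mem (α : ℝ) (n p : ℕ) : ∀ a ∈ zl α n p, ‖a‖ < 1 := by
  intro a ha
  rw [zl, List.mem_append] at ha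
  rcases ha with ha | ha
  · obtain ⟨j, _, rfl⟩ := List.mem_map.1 ha
    exact rj_norm _
  · rw [List.eq_of_mem_replicate ha]; simp

lemma B_bound {α : ℝ} (hα₀ : 0 < α) (hα₁ : α < 1) : ∃ C K : ℝ, 0 < C ∧ 0 < K ∧ ∀ n p : ℕ, K * (√n + 1) ≤ p →
    ∀ z : ℂ, ‖z‖ < 1 →
    ‖((zl α n p).map (fun a => ((1 + Complex.exp ((α : ℂ) * Complex.log (1 - z)))⁻¹ - a) / (1 - (starRingEnd ℂ a) * (1 + Complex.exp ((α : ℂ) * Complex.log (1 - z)))⁻¹))).prod‖ ^ 2 ≤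
      C * Real.exp (-Real.pi * (1 - α) * √(n / (2 * α))) ^ 2 * ‖1 - z‖ ^ (α - 1) := by
  have hpi := Real.pi_pos
  have h0 : 0 < α * Real.pi / 2 := by positivity
  have h1 : α * Real.pi / 2 < Real.pi / 2 := by nlinarith
  obtain ⟨K1, K2, hK1, H⟩ := sum_est hα₀ hα₁
  have hc := cos_pos' h0 h1
  set k := Real.cos (α * Real.pi / 2) with hk
  set β := (1 - α) / (2 * α) with hβ
  have hβ0 : 0 < β := div_pos (by linarith) (by linarith)
  refine ⟨Real.exp K2 ^ 2 * ((4:ℝ) ^ β) ^ 2, 2 * K1 / k, by positivity, by positivity, fun n p hp z hz => ?_⟩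
  obtain ⟨v, hv0, hv1, hvw, hvre, h1v, hφ, hwp⟩ := map_geo hα₀ hα₁ z hz
  rw [hφ]
  set c0 := Real.pi * √(2 * α) with hc0
  set x := -Real.log ‖v‖ with hx
  have hvp : 0 < ‖v‖ := norm_pos_iff.2 hv0
  have hx0 : 0 ≤ x := by rw [hx]; have := Real.log_nonpos hvp.le hv1; linarith
  have hex : Real.exp (-x) = ‖v‖ := by rw [hx, neg_neg, Real.exp_log hvp]
  set w := ‖1 - z‖ with hw
  have e1 : ((zl α n p).map (fun a => ((1 - v) / (1 + v) - a) / (1 - (starRingEnd ℂ a) * ((1 - v) / (1 + v))))).prod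
      = (∏ j ∈ Finset.range n, ((Real.exp (-(c0 * √n - c0 * √((j+1 : ℕ) : ℝ))) : ℝ) - v) / ((Real.exp (-(c0 * √n - c0 * √((j+1 : ℕ) : ℝ))) : ℝ) + v)) * ((1 - v) / (1 + v)) ^ p := by
    rw [zl, List.map_append, List.prod_append, List.map_map, Finset.prod_map_toList]
    congr 1
    · refine Finset.prod_congr rfl fun j _ => ?_
      exact rj_fac _ v h1v
    · simp
  have e2 : ‖((zl α n p).map (fun a => ((1 - v) / (1 + v) - a) / (1 - (starRingEnd ℂ a) * ((1 - v) / (1 + v))))).prod‖ ≤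
      Real.exp K2 * Real.exp (-(β * (c0 * √n))) * Real.exp (β * x) := by
    rw [e1, norm_mul, norm_prod, norm_pow]
    have a1 : ∏ j ∈ Finset.range n, ‖(((Real.exp (-(c0 * √n - c0 * √((j+1 : ℕ) : ℝ))) : ℝ) - v) / ((Real.exp (-(c0 * √n - c0 * √((j+1 : ℕ) : ℝ))) : ℝ) + v) : ℂ)‖ ≤
        ∏ j ∈ Finset.range n, Real.exp (-gg (α * Real.pi / 2) (x - (c0 * √n - c0 * √((j+1 : ℕ) : ℝ)))) :=
      Finset.prod_le_prod (fun j _ => norm_nonneg _) fun j _ => fac_bound h0 h1 v hv0 hvre _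
    have a2 := pow_le_pow_left₀ (norm_nonneg _) (phi_norm v hv1 h1v hvre hc.le) p
    refine (mul_le_mul a1 a2 (by positivity) (Finset.prod_nonneg fun j _ => (Real.exp_pos _).le)).trans ?_
    rw [← Real.exp_sum, ← Real.exp_nat_mul, ← Real.exp_add, ← Real.exp_add, ← Real.exp_add, Finset.sum_neg_distrib]
    apply Real.exp_le_exp.2
    have a3 := H n x hx0
    rw [hex] at a3
    have a4 : K1 * (√n + 1) * ‖v‖ ≤ p * (k * ‖v‖ / 2) := by
      have : K1 * (√n + 1) ≤ p * (k / 2) := by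
        have := mul_le_mul_of_nonneg_right hp (show 0 ≤ k / 2 by positivity)
        refine le_trans (le_of_eq ?_) this
        field_simp
      have := mul_le_mul_of_nonneg_right this hvp.le
      linarith
    linarith
  have e3 : Real.exp (-(β * (c0 * √n))) = Real.exp (-Real.pi * (1 - α) * √(n / (2 * α))) := by
    congr 1
    rw [Real.sqrt_div (by positivity), hβ, hc0]
    have : √(2 * α) ^ 2 = 2 * α := Real.sq_sqrt (by positivity)
    have h2 : (0:ℝ) < √(2 * α) := by positivity
    rw [show (2 * α) = √(2 * α) ^ 2 from this.symm, Real.sqrt_sq h2.le]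
    field_simp
  have e4 : Real.exp (β * x) ^ 2 ≤ ((4:ℝ) ^ β) ^ 2 * w ^ (α - 1) := by
    have b1 : Real.exp (β * x) = (‖v‖⁻¹) ^ β := by
      rw [Real.rpow_def_of_pos (by positivity), Real.log_inv, hx, mul_comm]
    have b2 : ‖v‖⁻¹ ≤ 4 * (w ^ α)⁻¹ := by
      have : 0 < w ^ α := by positivity
      rw [inv_le_comm₀ hvp (by positivity)]
      refine le_trans (le_of_eq ?_) hvw
      field_simp
    have b3 : (‖v‖⁻¹) ^ β ≤ 4 ^ β * ((w ^ α)⁻¹) ^ β := by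
      rw [← Real.mul_rpow (by norm_num) (by positivity)]
      exact Real.rpow_le_rpow (by positivity) b2 hβ0.le
    have b4 : (((w ^ α)⁻¹) ^ β) ^ 2 = w ^ (α - 1) := by
      rw [← Real.rpow_neg hwp.le, ← Real.rpow_mul hwp.le, ← Real.rpow_natCast, ← Real.rpow_mul hwp.le]
      congr 1
      rw [hβ]; push_cast; field_simp; ring
    rw [b1, ← b4, ← mul_pow]
    exact pow_le_pow_left₀ (by positivity) b3 2
  rw [e3] at e2
  calc _ ≤ (Real.exp K2 * Real.exp (-Real.pi * (1 - α) * √(n / (2 * α))) * Real.exp (β * x)) ^ 2 := pow_le_pow_left₀ (norm_nonneg _) e2 2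
    _ = Real.exp K2 ^ 2 * Real.exp (-Real.pi * (1 - α) * √(n / (2 * α))) ^ 2 * Real.exp (β * x) ^ 2 := by ring
    _ ≤ Real.exp K2 ^ 2 * Real.exp (-Real.pi * (1 - α) * √(n / (2 * α))) ^ 2 * (((4:ℝ) ^ β) ^ 2 * w ^ (α - 1)) := by gcongr
    _ = _ := by ring

lemma one_sub_zc {r t : ℝ} (hr : 1 / 4 ≤ r) (ht : |t| ≤ Real.pi) : |t| / Real.pi ≤ ‖1 - zc r t‖ := by
  have hpi := Real.pi_pos
  refine le_of_sq_le_sq' ?_ (norm_nonneg _)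
  have h := Real.cos_le_one_sub_mul_cos_sq ht
  have e : ‖1 - zc r t‖ ^ 2 = (1 - r) ^ 2 + 2 * r * (1 - Real.cos t) := by
    rw [← Complex.normSq_eq_norm_sq, Complex.normSq_apply, zc]
    simp only [sub_re, one_re, sub_im, one_im, Complex.re_ofReal_mul, Complex.im_ofReal_mul, Complex.exp_ofReal_mul_I_re, Complex.exp_ofReal_mul_I_im]
    linear_combination r ^ 2 * Real.sin_sq_add_cos_sq t
  rw [e, div_pow, sq_abs]
  have h2 : 2 / Real.pi ^ 2 * t ^ 2 = 2 * (t ^ 2 / Real.pi ^ 2) := by ring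
  rw [h2] at h
  have : 0 ≤ t ^ 2 / Real.pi ^ 2 := by positivity
  nlinarith [sq_nonneg (1 - r), mul_nonneg (show 0 ≤ r - 1/4 by linarith) this]

lemma TM_bound {α : ℝ} (hα₀ : 0 < α) (hα₁ : α < 1) 
    (T : H2 →L[ℂ] H2)
    (hT : ∀ (a : H2) (z : ℂ), ‖z‖ < 1 → fa (T a) z = fa a ((1 + Complex.exp ((α : ℂ) * Complex.log (1 - z)))⁻¹)) :
    ∃ C K : ℝ, 0 < C ∧ 0 < K ∧ ∀ n p : ℕ, K * (√n + 1) ≤ p → ∀ M, IsMul (zl α n p) M → ∀ g : H2,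
      ‖T (M g)‖ ≤ C * Real.exp (-Real.pi * (1 - α) * √(n / (2 * α))) * ‖g‖ := by
  have hpi := Real.pi_pos
  have h0 : 0 < α * Real.pi / 2 := by positivity
  have h1 : α * Real.pi / 2 < Real.pi / 2 := by nlinarith
  have hk := cos_pos' h0 h1
  set k := Real.cos (α * Real.pi / 2) with hkd
  obtain ⟨C, K, hC, hK, HB⟩ := B_bound hα₀ hα₁
  set c := k / (8 * Real.pi ^ α) with hc
  have hcp : 0 < c := by positivity
  obtain ⟨C2, hC2, HH⟩ := hilbert_ineq α c hα₀ hcp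
  refine ⟨√(C * Real.pi ^ (1 - α) * C2), K, by positivity, hK, fun n p hp M hM g => ?_⟩
  set E := Real.exp (-Real.pi * (1 - α) * √(n / (2 * α))) with hE
  set F : ℝ → ℝ := fun t => ∑' k : ℕ, ‖g k‖ * Real.exp (-c * k * t ^ α) with hF
  have pt : ∀ z : ℂ, ‖z‖ < 1 → ∀ t : ℝ, 0 < t → t / Real.pi ≤ ‖1 - z‖ →
      ‖fa (T (M g)) z‖ ^ 2 ≤ C * Real.pi ^ (1 - α) * E ^ 2 * (t ^ (α - 1) * F t ^ 2) := by
    intro z hz t ht htw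
    have hB := HB n p hp z hz
    obtain ⟨v, hv0, hv1, hvw, hvre, h1v, hφ, hwp⟩ := map_geo hα₀ hα₁ z hz
    have hvp : 0 < ‖v‖ := norm_pos_iff.2 hv0
    have hpn := phi_norm v hv1 h1v hvre hk.le
    rw [← hφ] at hpn
    have hφ1 : ‖(1 + Complex.exp ((α : ℂ) * Complex.log (1 - z)))⁻¹‖ < 1 := by
      refine hpn.trans_lt ?_
      rw [Real.exp_lt_one_iff]
      have : 0 < k * ‖v‖ / 2 := by positivity
      linarith
    rw [hT _ z hz, hM.2.1 g _ hφ1, norm_mul, mul_pow]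
    have htp : 0 < t / Real.pi := by positivity
    have hwα : (t / Real.pi) ^ α ≤ ‖1 - z‖ ^ α := Real.rpow_le_rpow htp.le htw hα₀.le
    have q1 : ‖(1 + Complex.exp ((α : ℂ) * Complex.log (1 - z)))⁻¹‖ ≤ Real.exp (-c * t ^ α) := by
      refine hpn.trans (Real.exp_le_exp.2 ?_)
      have : c * t ^ α = k * ((t / Real.pi) ^ α / 4) / 2 := by
        rw [Real.div_rpow ht.le hpi.le, hc]; field_simp; norm_num
      have h2 : k * ((t / Real.pi) ^ α / 4) / 2 ≤ k * ‖v‖ / 2 := by gcongr; linarith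
      linarith
    set ph := (1 + Complex.exp ((α : ℂ) * Complex.log (1 - z)))⁻¹ with hph
    have tp : 0 < t ^ α := by positivity
    have q2 : ‖fa g ph‖ ≤ F t := by
      have hlt : Real.exp (-c * t ^ α) < 1 := by
        rw [Real.exp_lt_one_iff]
        have := mul_pos hcp tp
        linarith
      have hs := coeff_summable g (Real.exp (-c * t ^ α)) (Real.exp_pos _).le hlt
      have es : ∀ k : ℕ, Real.exp (-c * k * t ^ α) = Real.exp (-c * t ^ α) ^ k := by
        intro k; rw [← Real.exp_nat_mul]; congr 1; ring
      simp only [hF, es]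
      refine tsum_of_norm_bounded hs.hasSum fun k => ?_
      rw [norm_mul, norm_pow]
      gcongr
    have q3 : ‖1 - z‖ ^ (α - 1) ≤ Real.pi ^ (1 - α) * t ^ (α - 1) := by
      have : (t / Real.pi) ^ (α - 1) = Real.pi ^ (1 - α) * t ^ (α - 1) := by
        rw [Real.div_rpow ht.le hpi.le, show (1 - α) = -(α - 1) by ring, Real.rpow_neg hpi.le]
        field_simp
      rw [← this]
      exact Real.rpow_le_rpow_of_nonpos htp htw (by linarith)
    have q4 : ‖fa g ph‖ ^ 2 ≤ F t ^ 2 := pow_le_pow_left₀ (norm_nonneg _) q2 2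
    calc _ ≤ (C * E ^ 2 * ‖1 - z‖ ^ (α - 1)) * F t ^ 2 := by gcongr
      _ ≤ (C * E ^ 2 * (Real.pi ^ (1 - α) * t ^ (α - 1))) * F t ^ 2 := by gcongr
      _ = _ := by ring
  have main := norm_sq_le (T (M g)) (fun t => ENNReal.ofReal (C * Real.pi ^ (1 - α) * E ^ 2) * ENNReal.ofReal (t ^ (α - 1) * F t ^ 2)) (by
    intro r t hr hr1 ht htpi
    have hr0 : 0 ≤ r := by linarith
    constructor
    · rw [← ENNReal.ofReal_mul (by positivity)]
      apply ENNReal.ofReal_le_ofReal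
      apply pt _ (by rw [zc_norm _ _ hr0]; exact hr1) t ht
      have := one_sub_zc (t := t) hr (by rwa [abs_of_pos ht])
      rwa [abs_of_pos ht] at this
    · rw [← ENNReal.ofReal_mul (by positivity)]
      apply ENNReal.ofReal_le_ofReal
      apply pt _ (by rw [zc_norm _ _ hr0]; exact hr1) t ht
      have := one_sub_zc (t := -t) hr (by rwa [abs_neg, abs_of_pos ht])
      rwa [abs_neg, abs_of_pos ht] at this)
  rw [lintegral_const_mul' _ _ ENNReal.ofReal_ne_top] at main
  have m2 := main.trans (mul_le_mul_right (HH g) _)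
  rw [← ENNReal.ofReal_mul (by positivity), ENNReal.ofReal_le_ofReal_iff (by positivity)] at m2
  refine le_of_sq_le_sq' ?_ (by positivity)
  refine m2.trans (le_of_eq ?_)
  rw [mul_pow, mul_pow, Real.sq_sqrt (by positivity)]
  ring


lemma approxNum_le (T R : H2 →L[ℂ] H2) (n : ℕ) (hR : LinearMap.rank R.toLinearMap ≤ ((n - 1 : ℕ) : Cardinal)) :
    approxNum T n ≤ ‖T - R‖ := by
  unfold approxNum
  refine csInf_le ⟨0, ?_⟩ ⟨R, ?_, ?_, rfl⟩
  · rintro c ⟨R, _, _, rfl⟩; exact norm_nonneg _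
  · exact Module.rank_lt_aleph0_iff.1 (hR.trans_lt (Cardinal.natCast_lt_aleph0))
  · exact Module.finrank_le_of_rank_le hR

lemma upper {α : ℝ} (hα₀ : 0 < α) (hα₁ : α < 1) 
    (T : H2 →L[ℂ] H2)
    (hT : ∀ (a : H2) (z : ℂ), ‖z‖ < 1 → fa (T a) z = fa a ((1 + Complex.exp ((α : ℂ) * Complex.log (1 - z)))⁻¹)) :
    ∃ C : ℝ, 0 < C ∧ ∀ n : ℕ, 1 ≤ n → approxNum T n ≤ C * Real.exp (-Real.pi * (1 - α) * Real.sqrt (n / (2 * α))) := by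
  obtain ⟨C, K, hC, hK, H⟩ := TM_bound hα₀ hα₁ T hT
  have hpi := Real.pi_pos
  set b := Real.pi * (1 - α) / √(2 * α) with hb
  have hb0 : 0 < b := div_pos (mul_pos hpi (by linarith)) (by positivity)
  have hexp : ∀ n : ℕ, -Real.pi * (1 - α) * Real.sqrt (n / (2 * α)) = -(b * √n) := by
    intro n
    rw [Real.sqrt_div (by positivity), hb]; ring
  simp only [hexp] at H ⊢
  set A := 2 * K + 2 with hA
  refine ⟨(C + ‖T‖) * Real.exp (b * A), by positivity, fun n hn => ?_⟩
  set p := ⌈K * (√n + 1)⌉₊ with hp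
  have hp1 : K * (√n + 1) ≤ p := Nat.le_ceil _
  have hp2 : (p:ℝ) < K * (√n + 1) + 1 := Nat.ceil_lt_add_one (by positivity)
  set m := n - 1 - p with hm
  have hn1 : (1:ℝ) ≤ √n := by
    rw [Real.one_le_sqrt]; exact_mod_cast hn
  have hnm : (n:ℝ) ≤ m + p + 1 := by
    have : n ≤ m + p + 1 := by omega
    exact_mod_cast this
  have hs1 : √(n:ℝ) ^ 2 = n := Real.sq_sqrt (by positivity)
  have hs2 : √(m:ℝ) ^ 2 = m := Real.sq_sqrt (by positivity)
  have hmn : √(m:ℝ) ≤ √n := Real.sqrt_le_sqrt (by exact_mod_cast (by omega : m ≤ n))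
  have hm0 := Real.sqrt_nonneg (m:ℝ)
  have hA' : √(n:ℝ) ≤ √m + A := by
    by_contra hcon
    push Not at hcon
    have a1 : (√(n:ℝ) - √m) * (√n + √m) ≤ A * √n := by
      have : (√(n:ℝ) - √m) * (√n + √m) = n - m := by linear_combination hs1 - hs2
      rw [this, hA]; nlinarith
    nlinarith
  have hE : Real.exp (-(b * √m)) ≤ Real.exp (b * A) * Real.exp (-(b * √n)) := by
    rw [← Real.exp_add]
    apply Real.exp_le_exp.2
    nlinarith
  by_cases hcase : p ≤ n - 1
  · obtain ⟨M, hM⟩ := mulList (zl α m p) (zl_mem α m p)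
    have hTM := H m p (le_trans (by gcongr) hp1) M hM
    obtain ⟨_, _, P, D, hP, hD, hf⟩ := hM
    have hr : LinearMap.rank (T ∘L P).toLinearMap ≤ ((n - 1 : ℕ) : Cardinal) := by
      have h1 : LinearMap.rank (T.toLinearMap ∘ₗ P.toLinearMap) ≤ LinearMap.rank P.toLinearMap := LinearMap.rank_comp_le_right _ _
      refine h1.trans (hP.trans ?_)
      rw [zl_len]
      exact_mod_cast (by omega : m + p ≤ n - 1)
    refine (approxNum_le T (T ∘L P) n hr).trans ?_
    have : ‖T - T ∘L P‖ ≤ C * Real.exp (-(b * √m)) := by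
      refine ContinuousLinearMap.opNorm_le_bound _ (by positivity) fun f => ?_
      have e : (T - T ∘L P) f = T (M (D f)) := by
        have := congrArg T (hf f)
        rw [map_add] at this
        simp only [sub_apply, ContinuousLinearMap.comp_apply]
        rw [sub_eq_iff_eq_add', ← this]
      rw [e]
      refine (hTM _).trans ?_
      gcongr
      exact hD f
    refine this.trans ?_
    calc C * Real.exp (-(b * √m)) ≤ C * (Real.exp (b * A) * Real.exp (-(b * √n))) := by gcongr
      _ ≤ (C + ‖T‖) * (Real.exp (b * A) * Real.exp (-(b * √n))) := by gcongr; linarith [norm_nonneg T]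
      _ = _ := by ring
  · have hm : m = 0 := by omega
    refine (approxNum_le T 0 n (by simp)).trans ?_
    rw [sub_zero]
    have h1 : 1 ≤ Real.exp (b * A) * Real.exp (-(b * √n)) := by
      simpa [hm] using hE
    calc ‖T‖ = ‖T‖ * 1 := by ring
      _ ≤ ‖T‖ * (Real.exp (b * A) * Real.exp (-(b * √n))) := by gcongr
      _ ≤ (C + ‖T‖) * (Real.exp (b * A) * Real.exp (-(b * √n))) := by gcongr; linarith
      _ = _ := by ring


lemma lower_gen (T R : H2 →L[ℂ] H2) (n : ℕ) (hn : 1 ≤ n)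
    (hfd : FiniteDimensional ℂ (LinearMap.range R.toLinearMap))
    (hrank : Module.finrank ℂ (LinearMap.range R.toLinearMap) ≤ n - 1)
    (z p : Fin n → ℂ) (hz : ∀ j, ‖z j‖ < 1) (hp : ∀ j, ‖p j‖ < 1)
    (hT : ∀ a j, fa (T a) (z j) = fa a (p j)) (δ : ℝ)
    (hδ : ∀ i, δ * ‖krn (z i) (hz i)‖ ≤ (∏ j ∈ Finset.univ.erase i, ‖(p i - p j) / (1 - (starRingEnd ℂ (p j)) * p i)‖) * ‖krn (p i) (hp i)‖) :
    δ / n ≤ ‖T - R‖ := by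
  let E : LinearMap.range R.toLinearMap →ₗ[ℂ] (Fin n → ℂ) :=
    { toFun := fun h j => fa (h : H2) (z j)
      map_add' := fun x y => by ext j; exact fa_add _ _ _ (hz j)
      map_smul' := fun c x => by ext j; exact fa_smul _ _ _ (hz j) }
  have hE : LinearMap.range E < ⊤ := by
    rw [lt_top_iff_ne_top]
    intro h
    have h1 := LinearMap.finrank_range_le E
    rw [h, finrank_top, Module.finrank_fin_fun] at h1
    omega
  obtain ⟨f, hf0, hf⟩ := Submodule.exists_le_ker_of_lt_top _ hE
  set c : Fin n → ℂ := fun j => f (Pi.single j 1) with hc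
  have hfx : ∀ x : Fin n → ℂ, f x = ∑ j, x j * c j := by
    intro x
    have := LinearMap.pi_apply_eq_sum_univ f x
    rw [this]
    refine Finset.sum_congr rfl fun j _ => ?_
    rw [smul_eq_mul, hc]
    congr 2
    ext k
    simp [Pi.single_apply, eq_comm]
  have hkp : ∀ (z : ℂ) (hz : ‖z‖ < 1), 0 < ‖krn z hz‖ := by
    intro z hz
    have h := krn_norm_sq z hz
    have : 0 < (1 - ‖z‖ ^ 2)⁻¹ := by
      apply inv_pos.2
      nlinarith [norm_nonneg z]
    rw [← h] at this
    rcases (norm_nonneg (krn z hz)).lt_or_eq with h | h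
    · exact h
    · rw [← h] at this; simp at this
  have : Nonempty (Fin n) := ⟨⟨0, by omega⟩⟩
  obtain ⟨i, hi⟩ := Finite.exists_max (fun j => ‖c j‖ * ‖krn (z j) (hz j)‖)
  have hci : 0 < ‖c i‖ := by
    rcases (norm_nonneg (c i)).lt_or_eq with h | h
    · exact h
    · exfalso
      apply hf0
      ext x
      have : ∀ j, c j = 0 := by
        intro j
        have h2 := hi j
        rw [← h, zero_mul] at h2
        have h3 := hkp (z j) (hz j)
        have : ‖c j‖ ≤ 0 := by
          by_contra hcon
          push Not at hcon
          nlinarith [mul_pos hcon h3]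
        exact norm_le_zero_iff.1 this
      simp [hfx, this]
  set l : List ℂ := (Finset.univ.erase i).toList.map p with hl
  obtain ⟨M, hM1, hM2, -⟩ := mulList l (by
    intro a ha
    obtain ⟨j, _, rfl⟩ := List.mem_map.1 ha
    exact hp j)
  have hprod : ∀ w, (l.map (fun a => (w - a) / (1 - (starRingEnd ℂ a) * w))).prod = ∏ j ∈ Finset.univ.erase i, (w - p j) / (1 - (starRingEnd ℂ (p j)) * w) := by
    intro w
    rw [hl, List.map_map, Finset.prod_map_toList]; rfl
  set g := M (krn (p i) (hp i)) with hg
  have hgn : ‖g‖ = ‖krn (p i) (hp i)‖ := hM1 _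
  have hgj : ∀ j, j ≠ i → fa g (p j) = 0 := by
    intro j hj
    rw [hg, hM2 _ _ (hp j), hprod, Finset.prod_eq_zero (i := j) (by simp [hj]) (by simp), zero_mul]
  have hgi : ‖fa g (p i)‖ = (∏ j ∈ Finset.univ.erase i, ‖(p i - p j) / (1 - (starRingEnd ℂ (p j)) * p i)‖) * ‖krn (p i) (hp i)‖ ^ 2 := by
    rw [hg, hM2 _ _ (hp i), hprod, fa_krn_self, norm_mul, norm_prod, Complex.norm_real, Real.norm_of_nonneg (by positivity)]
  have h1 : ∑ j, fa ((T - R) g) (z j) * c j = fa g (p i) * c i := by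
    have e1 : ∀ j, fa ((T - R) g) (z j) = fa g (p j) - fa (R g) (z j) := by
      intro j
      rw [sub_apply, fa_sub _ _ _ (hz j), hT]
    have e2 : ∑ j, fa (R g) (z j) * c j = 0 := by
      rw [← hfx (fun j => fa (R g) (z j))]
      have : (fun j => fa (R g) (z j)) ∈ LinearMap.range E := ⟨⟨R g, ⟨g, rfl⟩⟩, rfl⟩
      exact hf this
    simp only [e1, sub_mul, Finset.sum_sub_distrib, e2, sub_zero]
    refine Finset.sum_eq_single i (fun j _ hj => by rw [hgj j hj, zero_mul]) (by simp)
  have h2 : ‖∑ j, fa ((T - R) g) (z j) * c j‖ ≤ n * (‖T - R‖ * ‖g‖ * (‖c i‖ * ‖krn (z i) (hz i)‖)) := by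
    calc _ ≤ ∑ j, ‖fa ((T - R) g) (z j) * c j‖ := norm_sum_le _ _
      _ ≤ ∑ j : Fin n, (‖T - R‖ * ‖g‖ * (‖c i‖ * ‖krn (z i) (hz i)‖)) := by
        refine Finset.sum_le_sum fun j _ => ?_
        rw [norm_mul]
        have a1 := fa_bound (z j) (hz j) ((T - R) g)
        have a2 := (T - R).le_opNorm g
        calc ‖fa ((T - R) g) (z j)‖ * ‖c j‖ ≤ (‖krn (z j) (hz j)‖ * (‖T - R‖ * ‖g‖)) * ‖c j‖ := by
              gcongr
              exact a1.trans (by gcongr)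
          _ = ‖T - R‖ * ‖g‖ * (‖c j‖ * ‖krn (z j) (hz j)‖) := by ring
          _ ≤ _ := mul_le_mul_of_nonneg_left (hi j) (by positivity)
      _ = _ := by simp
  rw [h1, norm_mul, hgi, hgn] at h2
  have hk := hkp (p i) (hp i)
  have hkz := hkp (z i) (hz i)
  have h3 := hδ i
  set B := ∏ j ∈ Finset.univ.erase i, ‖(p i - p j) / (1 - (starRingEnd ℂ (p j)) * p i)‖
  set a := ‖krn (p i) (hp i)‖
  set b := ‖krn (z i) (hz i)‖
  have hn0 : (0:ℝ) < n := by exact_mod_cast hn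
  rw [div_le_iff₀ hn0]
  have h4 : (δ * b) * (a * ‖c i‖) ≤ (‖T - R‖ * n * b) * (a * ‖c i‖) := by
    calc (δ * b) * (a * ‖c i‖) ≤ (B * a) * (a * ‖c i‖) := by gcongr
      _ = B * a ^ 2 * ‖c i‖ := by ring
      _ ≤ _ := h2
      _ = _ := by ring
  have h5 := le_of_mul_le_mul_right h4 (by positivity)
  exact le_of_mul_le_mul_right h5 hkz


/-- log of the inverse pseudo-hyperbolic distance -/
def lf (y h : ℝ) (k : ℕ) : ℝ :=
  1 / 2 * Real.log ((1 + 2 * Real.exp (-h * k) * Real.cos (2 * y) + Real.exp (-h * k) ^ 2) / (1 - Real.exp (-h * k)) ^ 2)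

lemma lf_zero (y h : ℝ) : lf y h 0 = 0 := by simp [lf]

lemma cos2_gt {y : ℝ} (h0 : 0 < y) (h1 : y < Real.pi / 2) : -1 < Real.cos (2 * y) := by
  rw [Real.cos_two_mul]
  have := cos_pos' h0 h1
  nlinarith [pow_pos this 2]

lemma lf_ser {y h : ℝ} (h0 : 0 < y) (h1 : y < Real.pi / 2) (hh : 0 < h) (k : ℕ) (hk : 1 ≤ k) :
    HasSum (fun m : ℕ => (1 - Real.cos (m * (2 * y + Real.pi))) / m * Real.exp (-h * k) ^ m) (lf y h k) := by
  set Q := Real.exp (-h * k) with hQ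
  have hQ0 : 0 < Q := Real.exp_pos _
  have hQ1 : Q < 1 := by
    rw [hQ, Real.exp_lt_one_iff]
    have : (1:ℝ) ≤ k := by exact_mod_cast hk
    nlinarith
  have s1 := logSer Q 0 hQ0.le hQ1
  have s2 := logSer Q (2 * y + Real.pi) hQ0.le hQ1
  have s := s1.sub s2
  have c := cos2_gt h0 h1
  have hp : 0 < 1 + 2 * Q * Real.cos (2 * y) + Q ^ 2 := by
    nlinarith [sq_nonneg (1 - Q), mul_pos hQ0 (show 0 < Real.cos (2 * y) + 1 by linarith)]
  have ev : lf y h k = -(1 / 2) * Real.log (1 - 2 * Q * Real.cos 0 + Q ^ 2) -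
      -(1 / 2) * Real.log (1 - 2 * Q * Real.cos (2 * y + Real.pi) + Q ^ 2) := by
    rw [lf, ← hQ, Real.log_div hp.ne' (pow_ne_zero 2 (by linarith)), Real.cos_add_pi, Real.cos_zero]
    rw [show 1 - 2 * Q * 1 + Q ^ 2 = (1 - Q) ^ 2 by ring, show 1 - 2 * Q * -Real.cos (2 * y) + Q ^ 2 = 1 + 2 * Q * Real.cos (2 * y) + Q ^ 2 by ring]
    ring
  rw [ev]
  refine s.congr_fun fun m => ?_
  simp only [mul_zero, Real.cos_zero]; ring

lemma geo_le {a : ℝ} (ha : 0 < a) (N : ℕ) : ∑ k ∈ Finset.range N, Real.exp (-a) ^ (k + 1) ≤ 1 / a := by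
  set x := Real.exp (-a) with hx
  have hx0 : 0 < x := Real.exp_pos _
  have hx1 : x < 1 := by rw [hx, Real.exp_lt_one_iff]; linarith
  have e : ∑ k ∈ Finset.range N, x ^ (k + 1) ≤ x / (1 - x) := by
    have : ∑ k ∈ Finset.range N, x ^ (k + 1) = x * ∑ k ∈ Finset.range N, x ^ k := by
      rw [Finset.mul_sum]; refine Finset.sum_congr rfl fun k _ => by ring
    rw [this, div_eq_mul_inv]
    gcongr
    rw [← tsum_geometric_of_lt_one hx0.le hx1]
    exact (summable_geometric_of_lt_one hx0.le hx1).sum_le_tsum _ (fun k _ => by positivity)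
  refine e.trans ?_
  rw [div_le_div_iff₀ (by linarith) ha]
  have h1 : a + 1 ≤ Real.exp a := Real.add_one_le_exp a
  have h2 : x * Real.exp a = 1 := by rw [hx, ← Real.exp_add]; simp
  nlinarith [mul_le_mul_of_nonneg_left h1 hx0.le]

lemma lf_sum {y h : ℝ} (h0 : 0 < y) (h1 : y < Real.pi / 2) (hh : 0 < h) (N : ℕ) :
    ∑ k ∈ Finset.range N, lf y h (k + 1) ≤ (Real.pi ^ 2 / 4 - y ^ 2) / h := by
  have hpi := Real.pi_pos
  have s1 := hasSum_sum (fun (k : ℕ) (_ : k ∈ Finset.range N) => lf_ser h0 h1 hh (k + 1) (by omega))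
  have s2 := ((cosSum 0 le_rfl (by positivity)).sub (cosSum (2 * y + Real.pi) (by linarith) (by linarith))).mul_right (1 / h)
  have e : (Real.pi ^ 2 / 6 - Real.pi * 0 / 2 + 0 ^ 2 / 4 - (Real.pi ^ 2 / 6 - Real.pi * (2 * y + Real.pi) / 2 + (2 * y + Real.pi) ^ 2 / 4)) * (1 / h) = (Real.pi ^ 2 / 4 - y ^ 2) / h := by
    field_simp; ring
  rw [e] at s2
  refine hasSum_le (fun m => ?_) s1 s2
  rcases Nat.eq_zero_or_pos m with rfl | hm
  · simp
  have hm' : (0:ℝ) < m := by exact_mod_cast hm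
  rw [← Finset.mul_sum]
  have e2 : ∀ k : ℕ, Real.exp (-h * ((k + 1 : ℕ) : ℝ)) ^ m = Real.exp (-(h * m)) ^ (k + 1) := by
    intro k
    rw [← Real.exp_nat_mul, ← Real.exp_nat_mul]; congr 1; ring
  simp only [e2]
  have g := geo_le (mul_pos hh hm') N
  have hc : 0 ≤ (1 - Real.cos (m * (2 * y + Real.pi))) / m := by
    apply div_nonneg _ hm'.le
    linarith [Real.cos_le_one (m * (2 * y + Real.pi))]
  refine (mul_le_mul_of_nonneg_left g hc).trans (le_of_eq ?_)
  simp only [mul_zero, Real.cos_zero]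
  field_simp

lemma lf_sum_dist {y h : ℝ} (h0 : 0 < y) (h1 : y < Real.pi / 2) (hh : 0 < h) (n i : ℕ) (hi : i < n) :
    ∑ j ∈ Finset.range n, lf y h (Nat.dist i j) ≤ 2 * ((Real.pi ^ 2 / 4 - y ^ 2) / h) := by
  rw [Finset.range_eq_Ico, ← Finset.sum_Ico_consecutive _ (Nat.zero_le i) hi.le, ← Finset.range_eq_Ico]
  have a1 : ∑ j ∈ Finset.range i, lf y h (Nat.dist i j) = ∑ k ∈ Finset.range i, lf y h (k + 1) := by
    rw [← Finset.sum_range_reflect]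
    refine Finset.sum_congr rfl fun k hk => ?_
    have := Finset.mem_range.1 hk
    congr 1
    rw [Nat.dist]; omega
  have a2 : ∑ j ∈ Finset.Ico i n, lf y h (Nat.dist i j) = ∑ k ∈ Finset.range (n - i - 1), lf y h (k + 1) := by
    rw [Finset.sum_Ico_eq_sum_range]
    obtain ⟨d, hd⟩ : ∃ d, n - i = d + 1 := ⟨n - i - 1, by omega⟩
    rw [hd, Finset.sum_range_succ', show d + 1 - 1 = d by omega]
    rw [show Nat.dist i (i + 0) = 0 by simp [Nat.dist], lf_zero, add_zero]
    refine Finset.sum_congr rfl fun k hk => ?_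
    congr 1
    rw [Nat.dist]; omega
  rw [a1, a2]
  linarith [lf_sum h0 h1 hh i, lf_sum h0 h1 hh (n - i - 1)]

lemma psd {y h s : ℝ} (h0 : 0 < y) (h1 : y < Real.pi / 2) (hh : 0 < h) (i j : ℕ) (hij : i ≠ j) (vi vj : ℂ)
    (hvi : vi = (Real.exp (-(s + h * i)) : ℝ) * Complex.exp (y * I)) (hvj : vj = (Real.exp (-(s + h * j)) : ℝ) * Complex.exp (y * I))
    (hi1 : 1 + vi ≠ 0) (hj1 : 1 + vj ≠ 0) :
    ‖((1 - vi) / (1 + vi) - (1 - vj) / (1 + vj)) / (1 - (starRingEnd ℂ ((1 - vj) / (1 + vj))) * ((1 - vi) / (1 + vi)))‖ =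
      Real.exp (-lf y h (Nat.dist i j)) := by
  set a := Real.exp (-(s + h * i)) with ha
  set b := Real.exp (-(s + h * j)) with hb
  have hap : 0 < a := Real.exp_pos _
  have hbp : 0 < b := Real.exp_pos _
  have c := cos2_gt h0 h1
  have hj1' : 1 + (starRingEnd ℂ) vj ≠ 0 := by
    intro h
    apply hj1
    have := congrArg (starRingEnd ℂ) h
    simpa using this
  have e1 : (1 - vi) / (1 + vi) - (1 - vj) / (1 + vj) = (vj - vi) * (2 / ((1 + vi) * (1 + vj))) := by
    field_simp; ring
  have e2 : 1 - (starRingEnd ℂ ((1 - vj) / (1 + vj))) * ((1 - vi) / (1 + vi)) = (vi + starRingEnd ℂ vj) * (2 / ((1 + vi) * (1 + starRingEnd ℂ vj))) := by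
    rw [map_div₀, map_sub, map_add, map_one]
    field_simp; ring
  have hn : ‖(2 / ((1 + vi) * (1 + vj)) : ℂ)‖ = ‖(2 / ((1 + vi) * (1 + starRingEnd ℂ vj)) : ℂ)‖ := by
    have : ‖1 + (starRingEnd ℂ) vj‖ = ‖1 + vj‖ := by
      rw [← RCLike.norm_conj (1 + vj)]; simp
    rw [norm_div, norm_div, norm_mul, norm_mul, this]
  have hn0 : ‖(2 / ((1 + vi) * (1 + starRingEnd ℂ vj)) : ℂ)‖ ≠ 0 := by
    rw [norm_ne_zero_iff]
    exact div_ne_zero two_ne_zero (mul_ne_zero hi1 hj1')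
  rw [e1, e2, norm_div, norm_mul, norm_mul, hn, mul_div_mul_right _ _ hn0]
  have n1 : ‖vj - vi‖ ^ 2 = (a - b) ^ 2 := by
    rw [hvi, hvj, ← sub_mul, norm_mul, Complex.norm_exp_ofReal_mul_I, mul_one, ← Complex.ofReal_sub, Complex.norm_real, Real.norm_eq_abs, sq_abs]; ring
  have n2 : ‖vi + starRingEnd ℂ vj‖ ^ 2 = a ^ 2 + b ^ 2 + 2 * a * b * Real.cos (2 * y) := by
    rw [← Complex.normSq_eq_norm_sq, Complex.normSq_apply, hvi, hvj]
    simp only [add_re, add_im, Complex.conj_re, Complex.conj_im, Complex.re_ofReal_mul, Complex.im_ofReal_mul, Complex.exp_ofReal_mul_I_re, Complex.exp_ofReal_mul_I_im]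
    rw [Real.cos_two_mul]
    linear_combination (a - b) ^ 2 * Real.sin_sq_add_cos_sq y
  have key : ∀ (p q : ℝ) (k : ℕ), 0 < p → 0 < k → q = p * Real.exp (-h * k) →
      Real.exp (-lf y h k) ^ 2 = (p - q) ^ 2 / (p ^ 2 + q ^ 2 + 2 * p * q * Real.cos (2 * y)) := by
    intro p q k hp hk hq
    set Q := Real.exp (-h * k) with hQ
    have hQ0 : 0 < Q := Real.exp_pos _
    have hQ1 : Q < 1 := by
      rw [hQ, Real.exp_lt_one_iff]
      have : (0:ℝ) < k := by exact_mod_cast hk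
      nlinarith
    have hpp : 0 < 1 + 2 * Q * Real.cos (2 * y) + Q ^ 2 := by
      nlinarith [sq_nonneg (1 - Q), mul_pos hQ0 (show 0 < Real.cos (2 * y) + 1 by linarith)]
    have h1Q : 0 < 1 - Q := by linarith
    rw [← Real.exp_nat_mul, lf, ← hQ]
    have : ((2:ℕ):ℝ) * -(1 / 2 * Real.log ((1 + 2 * Q * Real.cos (2 * y) + Q ^ 2) / (1 - Q) ^ 2)) = -Real.log ((1 + 2 * Q * Real.cos (2 * y) + Q ^ 2) / (1 - Q) ^ 2) := by push_cast; ring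
    rw [this, Real.exp_neg, Real.exp_log (by positivity), inv_div, hq]
    have : p ^ 2 + (p * Q) ^ 2 + 2 * p * (p * Q) * Real.cos (2 * y) = p ^ 2 * (1 + 2 * Q * Real.cos (2 * y) + Q ^ 2) := by ring
    rw [this, show (p - p * Q) ^ 2 = p ^ 2 * (1 - Q) ^ 2 by ring, mul_div_mul_left _ _ (by positivity)]
  have fin : (‖vj - vi‖ / ‖vi + starRingEnd ℂ vj‖) ^ 2 = Real.exp (-lf y h (Nat.dist i j)) ^ 2 := by
    rw [div_pow, n1, n2]
    rcases lt_or_gt_of_ne hij with hl | hl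
    · rw [key a b _ hap (Nat.dist_pos_of_ne hij)]
      rw [ha, hb, ← Real.exp_add, Nat.dist_eq_sub_of_le hl.le, Nat.cast_sub hl.le]; congr 1; ring
    · rw [key b a _ hbp (Nat.dist_pos_of_ne hij)]
      · congr 1 <;> ring
      rw [ha, hb, ← Real.exp_add, Nat.dist_comm, Nat.dist_eq_sub_of_le hl.le, Nat.cast_sub hl.le]; congr 1; ring
  exact (pow_left_inj₀ (by positivity) (Real.exp_pos _).le two_ne_zero).1 fin


lemma pts {α y : ℝ} (hα₀ : 0 < α) (hα₁ : α < 1) (hy0 : 0 < y) (hy1 : y < α * Real.pi / 2) :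
    ∃ ε c : ℝ, 0 < ε ∧ 0 < c ∧ ∀ ρ : ℝ, 0 < ρ → ρ < ε → ∃ z : ℂ, ‖z‖ < 1 ∧
      (1 + Complex.exp ((α : ℂ) * Complex.log (1 - z)))⁻¹ = (1 - ρ * Complex.exp (y * I)) / (1 + ρ * Complex.exp (y * I)) ∧
      c * ρ ^ (1 / α) ≤ 1 - ‖z‖ ^ 2 := by
  have hpi := Real.pi_pos
  have hy2 : y < Real.pi / 2 := by nlinarith
  set y' := (y + α * Real.pi / 2) / 2 with hy'
  have hyy : y < y' := by rw [hy']; linarith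
  have hy'1 : y' < α * Real.pi / 2 := by rw [hy']; linarith
  have hca : 0 < Real.cos (y' / α) := by
    apply Real.cos_pos_of_mem_Ioo
    constructor
    · have : 0 < y' / α := by have := hy0.trans hyy; positivity
      linarith
    · rw [div_lt_iff₀ hα₀]; linarith
  set κ := Real.cos (y' / α) with hκ
  -- continuity of the argument
  have hct : ContinuousAt (fun ρ : ℝ => Complex.arg (2 * Complex.exp (y * I) / (1 - ρ * Complex.exp (y * I)))) 0 := by
    have h1 : ContinuousAt (fun ρ : ℝ => 2 * Complex.exp (y * I) / (1 - ρ * Complex.exp (y * I))) 0 := by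
      apply ContinuousAt.div
      · fun_prop
      · fun_prop
      · simp
    refine ContinuousAt.comp (g := Complex.arg) ?_ h1
    apply Complex.continuousAt_arg
    simp only [Complex.ofReal_zero, zero_mul, sub_zero, div_one]
    left
    have : (2 * Complex.exp (y * I)).re = 2 * Real.cos y := by
      rw [show (2:ℂ) = ((2:ℝ):ℂ) by norm_num, Complex.re_ofReal_mul, Complex.exp_ofReal_mul_I_re]
    rw [this]
    have := cos_pos' hy0 hy2
    linarith
  have harg0 : Complex.arg (2 * Complex.exp (y * I) / (1 - ((0:ℝ):ℂ) * Complex.exp (y * I))) = y := by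
    simp only [Complex.ofReal_zero, zero_mul, sub_zero, div_one]
    rw [show (2:ℂ) = ((2:ℝ):ℂ) by norm_num, Complex.arg_real_mul _ (by norm_num), Complex.arg_exp_mul_I, toIocMod_eq_self]
    constructor <;> linarith
  have hev : ∀ᶠ ρ : ℝ in nhds 0, |Complex.arg (2 * Complex.exp (y * I) / (1 - ρ * Complex.exp (y * I)))| < y' := by
    have := hct.abs
    refine this.eventually_lt_const ?_
    simp only
    rw [harg0, abs_of_pos hy0]; exact hyy
  obtain ⟨ε1, hε1, H1⟩ := Metric.eventually_nhds_iff.1 hev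
  have hκp : 0 < κ ^ α := by positivity
  refine ⟨min ε1 (min (1/2) (κ ^ α / 4)), κ, by positivity, hca, fun ρ hρ hρε => ?_⟩
  have r1 : ρ < ε1 := hρε.trans_le (min_le_left _ _)
  have r2 : ρ < 1 / 2 := hρε.trans_le ((min_le_right _ _).trans (min_le_left _ _))
  have r3 : ρ < κ ^ α / 4 := hρε.trans_le ((min_le_right _ _).trans (min_le_right _ _))
  set v : ℂ := ρ * Complex.exp (y * I) with hv
  have hvn : ‖v‖ = ρ := by
    rw [hv, norm_mul, Complex.norm_exp_ofReal_mul_I, mul_one, Complex.norm_real, Real.norm_of_nonneg hρ.le]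
  have hA := H1 (y := ρ) (by simpa [abs_of_pos hρ] using r1)
  rw [← hv] at hA
  have hv0 : v ≠ 0 := by rw [← norm_pos_iff, hvn]; exact hρ
  have h1v : 1 - v ≠ 0 := by
    intro h
    have : v = 1 := (sub_eq_zero.1 h).symm
    rw [this, norm_one] at hvn; linarith
  have h1v' : 1 + v ≠ 0 := by
    intro h
    have : v = -1 := by linear_combination h
    rw [this, norm_neg, norm_one] at hvn; linarith
  set u : ℂ := 2 * v / (1 - v) with hu
  have hu0 : u ≠ 0 := div_ne_zero (mul_ne_zero two_ne_zero hv0) h1v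
  have hargu : |Complex.arg u| < y' := by
    have : u = (ρ:ℂ) * (2 * Complex.exp (y * I) / (1 - v)) := by rw [hu, hv]; ring
    rw [this, Complex.arg_real_mul _ hρ]; exact hA
  have hlo : 1 - ρ ≤ ‖1 - v‖ := by
    have := norm_sub_norm_le (1:ℂ) v
    rwa [norm_one, hvn] at this
  have hhi : ‖1 - v‖ ≤ 2 := by
    have := norm_sub_le (1:ℂ) v
    rw [norm_one, hvn] at this; linarith
  have hun : ‖u‖ = 2 * ρ / ‖1 - v‖ := by
    rw [hu, norm_div, norm_mul, hvn]; norm_num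
  have h1vp : 0 < ‖1 - v‖ := norm_pos_iff.2 h1v
  have hu1 : ρ ≤ ‖u‖ := by
    rw [hun, le_div_iff₀ h1vp]; nlinarith
  have hu2 : ‖u‖ ≤ 4 * ρ := by
    rw [hun, div_le_iff₀ h1vp]; nlinarith
  have hup : 0 < ‖u‖ := norm_pos_iff.2 hu0
  set w : ℂ := Complex.exp (((1 / α : ℝ) : ℂ) * Complex.log u) with hw
  have hre : (((1 / α : ℝ) : ℂ) * Complex.log u).re = (1 / α) * Real.log ‖u‖ := by
    rw [Complex.re_ofReal_mul, Complex.log_re]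
  have him : (((1 / α : ℝ) : ℂ) * Complex.log u).im = (1 / α) * Complex.arg u := by
    rw [Complex.im_ofReal_mul, Complex.log_im]
  have hwn : ‖w‖ = ‖u‖ ^ (1 / α) := by
    rw [hw, Complex.norm_exp, hre, Real.rpow_def_of_pos hup, mul_comm]
  have hwn' : ‖w‖ = Real.exp ((1 / α) * Real.log ‖u‖) := by rw [hw, Complex.norm_exp, hre]
  have hab : |(1 / α) * Complex.arg u| ≤ y' / α := by
    rw [abs_mul, abs_of_pos (by positivity : 0 < 1 / α), one_div, div_eq_inv_mul]
    gcongr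
  have hyα : y' / α < Real.pi / 2 := by rw [div_lt_iff₀ hα₀]; linarith
  have hwre : ‖w‖ * κ ≤ w.re := by
    have e : w.re = ‖w‖ * Real.cos ((1 / α) * Complex.arg u) := by
      rw [hwn', hw, Complex.exp_re, hre, him]
    rw [e, ← Real.cos_abs ((1 / α) * Complex.arg u)]
    apply mul_le_mul_of_nonneg_left _ (norm_nonneg _)
    exact Real.cos_le_cos_of_nonneg_of_le_pi (abs_nonneg _) (by linarith) hab
  have hlogw : Complex.log w = ((1 / α : ℝ) : ℂ) * Complex.log u := by
    rw [hw]
    have := abs_le.1 (hab.trans hyα.le)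
    apply Complex.log_exp
    · rw [him]; linarith
    · rw [him]; linarith
  have hwu : Complex.exp ((α : ℂ) * Complex.log w) = u := by
    rw [hlogw, ← mul_assoc, ← Complex.ofReal_mul, mul_one_div_cancel hα₀.ne', Complex.ofReal_one, one_mul, Complex.exp_log hu0]
  have hwκ : ‖w‖ ≤ κ := by
    rw [hwn]
    have : ‖u‖ ≤ κ ^ α := by linarith
    calc ‖u‖ ^ (1 / α) ≤ (κ ^ α) ^ (1 / α) := Real.rpow_le_rpow hup.le this (by positivity)
      _ = κ := by rw [← Real.rpow_mul hca.le, mul_one_div_cancel hα₀.ne', Real.rpow_one]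
  have hwp : 0 < ‖w‖ := by rw [hwn]; positivity
  have hz : κ * ‖w‖ ≤ 1 - ‖1 - w‖ ^ 2 := by
    have : ‖1 - w‖ ^ 2 = 1 - 2 * w.re + ‖w‖ ^ 2 := by
      rw [← Complex.normSq_eq_norm_sq, ← Complex.normSq_eq_norm_sq, Complex.normSq_apply, Complex.normSq_apply]
      simp; ring
    rw [this]; nlinarith
  refine ⟨1 - w, ?_, ?_, ?_⟩
  · have : 0 < κ * ‖w‖ := by positivity
    have h2 : ‖1 - w‖ ^ 2 < 1 := by linarith
    by_contra hcon
    push Not at hcon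
    nlinarith
  · rw [sub_sub_cancel, hwu, hu]
    have : 1 + 2 * v / (1 - v) = (1 + v) / (1 - v) := by field_simp; ring
    rw [this, inv_div]
  · refine le_trans ?_ hz
    rw [hwn]
    gcongr

lemma krn_ratio {α c ρ y : ℝ} (hc : 0 < c) (hα₀ : 0 < α) (hρ : 0 < ρ) (hy0 : 0 < y) (hy1 : y < Real.pi / 2)
    (z p : ℂ) (hz : ‖z‖ < 1) (hp : ‖p‖ < 1) (hpe : p = (1 - ρ * Complex.exp (y * I)) / (1 + ρ * Complex.exp (y * I)))
    (hzc : c * ρ ^ (1 / α) ≤ 1 - ‖z‖ ^ 2) :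
    √(c / 4) * ρ ^ ((1 - α) / (2 * α)) * ‖krn z hz‖ ≤ ‖krn p hp‖ := by
  refine le_of_sq_le_sq' ?_ (norm_nonneg _)
  have hcos := cos_pos' hy0 hy1
  rw [mul_pow, mul_pow, krn_norm_sq, krn_norm_sq, Real.sq_sqrt (by positivity)]
  have hp1 : 0 < 1 - ‖p‖ ^ 2 := by nlinarith [norm_nonneg p]
  have hz1 : 0 < 1 - ‖z‖ ^ 2 := by nlinarith [norm_nonneg z]
  have hpb : 1 - ‖p‖ ^ 2 ≤ 4 * ρ := by
    set v : ℂ := ρ * Complex.exp (y * I) with hv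
    have hvre : v.re = ρ * Real.cos y := by rw [hv, Complex.re_ofReal_mul, Complex.exp_ofReal_mul_I_re]
    have n1 : ‖1 - v‖ ^ 2 = 1 - 2 * v.re + ‖v‖ ^ 2 := by
      rw [← Complex.normSq_eq_norm_sq, ← Complex.normSq_eq_norm_sq, Complex.normSq_apply, Complex.normSq_apply]
      simp; ring
    have n2 : ‖1 + v‖ ^ 2 = 1 + 2 * v.re + ‖v‖ ^ 2 := by
      rw [← Complex.normSq_eq_norm_sq, ← Complex.normSq_eq_norm_sq, Complex.normSq_apply, Complex.normSq_apply]
      simp; ring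
    have hvp : 0 < v.re := by rw [hvre]; positivity
    have hvl : v.re ≤ ρ := by rw [hvre]; nlinarith [Real.cos_le_one y]
    have hD : 1 ≤ ‖1 + v‖ ^ 2 := by rw [n2]; nlinarith [sq_nonneg ‖v‖]
    rw [hpe, norm_div, div_pow, sub_le_iff_le_add, ← sub_le_iff_le_add', le_div_iff₀ (by linarith), n1]
    rw [n2] at hD ⊢
    nlinarith [sq_nonneg ‖v‖]
  have e : (ρ ^ ((1 - α) / (2 * α))) ^ 2 = ρ ^ (1 / α) / ρ := by
    rw [← Real.rpow_natCast, ← Real.rpow_mul hρ.le]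
    nth_rewrite 3 [← Real.rpow_one ρ]
    rw [← Real.rpow_sub hρ]
    congr 1
    push_cast; field_simp
  rw [e]
  have hr : 0 < ρ ^ (1 / α) := by positivity
  calc c / 4 * (ρ ^ (1 / α) / ρ) * (1 - ‖z‖ ^ 2)⁻¹ ≤ c / 4 * (ρ ^ (1 / α) / ρ) * (c * ρ ^ (1 / α))⁻¹ := by gcongr
    _ = (4 * ρ)⁻¹ := by field_simp
    _ ≤ _ := by gcongr

set_option maxHeartbeats 2000000 in
lemma lower {α : ℝ} (hα₀ : 0 < α) (hα₁ : α < 1) 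
    (T : H2 →L[ℂ] H2)
    (hT : ∀ (a : H2) (z : ℂ), ‖z‖ < 1 → fa (T a) z = fa a ((1 + Complex.exp ((α : ℂ) * Complex.log (1 - z)))⁻¹)) :
    ∃ c : ℝ, 0 < c ∧ ∀ n : ℕ, 1 ≤ n → c * Real.exp (-Real.pi * (1 - α) * Real.sqrt (2 * n / α)) ≤ approxNum T n := by
  have hpi := Real.pi_pos
  set η := α * (1 - (1 - α) ^ 2 / 2) with hη
  have hη0 : 0 < η := by
    apply mul_pos hα₀; nlinarith
  have hη1 : η < α := by
    have : 0 < α * (1 - α) ^ 2 := mul_pos hα₀ (pow_pos (by linarith) 2)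
    rw [hη]; linarith
  have hη2 : 2 * α - 1 < η ^ 2 := by
    have h1 : 0 < (1 - α) ^ 2 := pow_pos (by linarith) 2
    have h2 : α ^ 2 < 1 := by nlinarith
    have h3 : α ^ 2 * (1 - α) ^ 2 < 1 * (1 - α) ^ 2 := by gcongr
    have h4 : η ^ 2 = α ^ 2 - α ^ 2 * (1 - α) ^ 2 + (α * (1 - α) ^ 2 / 2) ^ 2 := by rw [hη]; ring
    nlinarith [sq_nonneg (α * (1 - α) ^ 2 / 2)]
  set y := Real.pi / 2 * η with hy
  have hy0 : 0 < y := by positivity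
  have hy1 : y < α * Real.pi / 2 := by rw [hy]; nlinarith
  have hy2 : y < Real.pi / 2 := by nlinarith
  set J := Real.pi ^ 2 / 4 - y ^ 2 with hJ
  have hJ0 : 0 < J := by rw [hJ]; nlinarith
  have hJ1 : J < Real.pi ^ 2 * (1 - α) / 2 := by
    have : y ^ 2 = Real.pi ^ 2 / 4 * η ^ 2 := by rw [hy]; ring
    rw [hJ, this]
    nlinarith [mul_lt_mul_of_pos_left hη2 (show 0 < Real.pi ^ 2 / 4 by positivity)]
  set β := (1 - α) / (2 * α) with hβ
  have hβ0 : 0 < β := div_pos (by linarith) (by linarith)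
  set a := √(2 * J / β) with ha
  have ha0 : 0 < a := by positivity
  have ha2 : a ^ 2 = 2 * J / β := Real.sq_sqrt (by positivity)
  set D := β * a + 2 * J / a with hD
  set D' := Real.pi * (1 - α) * √(2 / α) with hD'
  have hDD : D < D' := by
    have e1 : D ^ 2 = 8 * J * β := by
      have : 2 * J / a = β * a := by
        rw [div_eq_iff ha0.ne']
        have : β * a ^ 2 = 2 * J := by rw [ha2]; field_simp
        linarith
      rw [hD, this]
      have : β * a ^ 2 = 2 * J := by rw [ha2]; field_simp
      linear_combination 4 * β * this
    have e2 : D' ^ 2 = Real.pi ^ 2 * (1 - α) ^ 2 * (2 / α) := by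
      rw [hD', mul_pow, mul_pow, Real.sq_sqrt (by positivity)]
    have hD'0 : 0 ≤ D' := by
      rw [hD']; have : 0 ≤ 1 - α := by linarith
      positivity
    refine lt_of_pow_lt_pow_left₀ 2 hD'0 ?_
    rw [e1, e2]
    have e3 : Real.pi ^ 2 * (1 - α) ^ 2 * (2 / α) = 8 * (Real.pi ^ 2 * (1 - α) / 2) * β := by
      rw [hβ]; field_simp; ring
    rw [e3]
    gcongr
  obtain ⟨ε, c, hε, hc, H⟩ := pts hα₀ hα₁ hy0 hy1
  set s0 := -Real.log (ε / 2) with hs0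
  have hes : Real.exp (-s0) = ε / 2 := by rw [hs0, neg_neg, Real.exp_log (by positivity)]
  set γ := D' - D with hγ
  have hγ0 : 0 < γ := by linarith
  refine ⟨√(c / 4) * Real.exp (-(β * s0)) * (γ ^ 2 / 2), by positivity, fun n hn => ?_⟩
  unfold approxNum
  refine le_csInf ⟨‖T - 0‖, 0, ?_, ?_, rfl⟩ ?_
  · have : LinearMap.range (0 : H2 →L[ℂ] H2).toLinearMap = ⊥ := by
      rw [ContinuousLinearMap.toLinearMap_zero, LinearMap.range_zero]
    rw [this]; infer_instance
  · have : LinearMap.range (0 : H2 →L[ℂ] H2).toLinearMap = ⊥ := by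
      rw [ContinuousLinearMap.toLinearMap_zero, LinearMap.range_zero]
    rw [this, finrank_bot]; omega
  rintro _ ⟨R, hR1, hR2, rfl⟩
  have hn0 : (0:ℝ) < n := by exact_mod_cast hn
  have hsn : 0 < √(n:ℝ) := by positivity
  have hsq : √(n:ℝ) ^ 2 = n := Real.sq_sqrt hn0.le
  set h := a / √n with hh
  have hh0 : 0 < h := by positivity
  set ρ : ℕ → ℝ := fun j => Real.exp (-(s0 + h * j)) with hρ
  have hρ0 : ∀ j, 0 < ρ j := fun j => Real.exp_pos _
  have hρε : ∀ j, ρ j < ε := by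
    intro j
    have : ρ j ≤ Real.exp (-s0) := by
      apply Real.exp_le_exp.2
      have : 0 ≤ h * j := by positivity
      linarith
    rw [hes] at this; linarith
  choose z hz hφ hzc using fun j : ℕ => H (ρ j) (hρ0 j) (hρε j)
  have h1v : ∀ j, 1 + (ρ j : ℂ) * Complex.exp (y * I) ≠ 0 := by
    intro j hcon
    have := congrArg Complex.re hcon
    simp only [add_re, one_re, zero_re, Complex.re_ofReal_mul, Complex.exp_ofReal_mul_I_re] at this
    have := mul_pos (hρ0 j) (cos_pos' hy0 hy2)
    linarith
  set p : ℕ → ℂ := fun j => (1 - ρ j * Complex.exp (y * I)) / (1 + ρ j * Complex.exp (y * I)) with hp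
  have hp1 : ∀ j, ‖p j‖ < 1 := by
    intro j
    obtain ⟨v, hv0, hv1, -, hvre, h1v, hφ', -⟩ := map_geo hα₀ hα₁ (z j) (hz j)
    have hk := cos_pos' (θ := α * Real.pi / 2) (by positivity) (by nlinarith)
    have := phi_norm v hv1 h1v hvre hk.le
    rw [← hφ', hφ j] at this
    refine this.trans_lt ?_
    rw [Real.exp_lt_one_iff]
    have := mul_pos hk (norm_pos_iff.2 hv0)
    linarith
  have key := lower_gen T R n hn hR1 hR2 (fun j => z j) (fun j => p j) (fun j => hz j) (fun j => hp1 j)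
    (fun a j => by rw [hT a _ (hz j), hφ j]) (√(c / 4) * Real.exp (-(β * s0)) * Real.exp (-(√n * D))) ?_
  · refine le_trans ?_ key
    rw [le_div_iff₀ hn0]
    have e1 : -Real.pi * (1 - α) * √(2 * n / α) = -(√n * D') := by
      rw [show 2 * (n:ℝ) / α = n * (2 / α) by ring, Real.sqrt_mul hn0.le, hD']; ring
    rw [e1]
    have e2 : γ ^ 2 / 2 * n ≤ Real.exp (γ * √n) := by
      have := Real.quadratic_le_exp_of_nonneg (show 0 ≤ γ * √n by positivity)
      rw [mul_pow, hsq] at this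
      have h2 : 0 < γ * √n := by positivity
      linarith
    have e3 : Real.exp (-(√n * D)) = Real.exp (γ * √n) * Real.exp (-(√n * D')) := by
      rw [← Real.exp_add]; congr 1; rw [hγ]; ring
    rw [e3]
    calc _ = √(c / 4) * Real.exp (-(β * s0)) * ((γ ^ 2 / 2 * n) * Real.exp (-(√n * D'))) := by ring
      _ ≤ _ := by gcongr
  · intro i
    have b1 := krn_ratio hc hα₀ (hρ0 i) hy0 hy2 (z i) (p i) (hz i) (hp1 i) rfl (hzc i)
    have b2 : Real.exp (-(2 * (J / h))) ≤ ∏ j ∈ Finset.univ.erase i, ‖(p i - p j) / (1 - (starRingEnd ℂ (p j)) * p i)‖ := by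
      have : ∏ j ∈ Finset.univ.erase i, ‖(p i - p j) / (1 - (starRingEnd ℂ (p j)) * p i)‖ = Real.exp (-∑ j ∈ Finset.univ.erase i, lf y h (Nat.dist i j)) := by
        rw [← Finset.sum_neg_distrib, Real.exp_sum]
        refine Finset.prod_congr rfl fun j hj => ?_
        have hji : (i:ℕ) ≠ j := fun hcon => (Finset.mem_erase.1 hj).1 (Fin.ext hcon).symm
        exact psd (s := s0) hy0 hy2 hh0 i j hji _ _ rfl rfl (h1v i) (h1v j)
      rw [this]
      apply Real.exp_le_exp.2
      rw [neg_le_neg_iff, Finset.sum_erase _ (by simp [lf_zero]), Fin.sum_univ_eq_sum_range (fun j => lf y h (Nat.dist i j))]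
      exact lf_sum_dist hy0 hy2 hh0 n i i.2
    have b3 : Real.exp (-(β * s0)) * Real.exp (-(β * (a * √n))) ≤ ρ i ^ β := by
      rw [← Real.exp_add, hρ, ← Real.exp_mul]
      apply Real.exp_le_exp.2
      have : h * (i:ℕ) ≤ a * √n := by
        have hin : ((i:ℕ):ℝ) ≤ n := by exact_mod_cast i.2.le
        calc h * (i:ℕ) ≤ h * n := by gcongr
          _ = a * √n := by rw [hh]; nth_rewrite 2 [← hsq]; field_simp
      nlinarith
    have b4 : Real.exp (-(√n * D)) = Real.exp (-(β * (a * √n))) * Real.exp (-(2 * (J / h))) := by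
      rw [← Real.exp_add, hD, hh]; congr 1; field_simp; ring
    calc _ = Real.exp (-(2 * (J / h))) * (√(c / 4) * (Real.exp (-(β * s0)) * Real.exp (-(β * (a * √n)))) * ‖krn (z i) (hz i)‖) := by
          rw [b4]; ring
      _ ≤ Real.exp (-(2 * (J / h))) * (√(c / 4) * ρ i ^ β * ‖krn (z i) (hz i)‖) := by gcongr
      _ ≤ Real.exp (-(2 * (J / h))) * ‖krn (p i) (hp1 i)‖ := by gcongr
      _ ≤ _ := by gcongr


theorem stmt3 (α : ℝ) (hα₀ : 0 < α) (hα₁ : α < 1)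
    (φ : ℂ → ℂ)
    (hφ : ∀ z : ℂ, φ z = (1 + Complex.exp ((α : ℂ) * Complex.log (1 - z)))⁻¹)
    (T : H2 →L[ℂ] H2)
    (hT : ∀ (a : H2) (z : ℂ), ‖z‖ < 1 → fa (T a) z = fa a (φ z)) :
    ∃ c C : ℝ, 0 < c ∧ 0 < C ∧ ∀ n : ℕ, 1 ≤ n →
      c * Real.exp (-Real.pi * (1 - α) * Real.sqrt (2 * n / α)) ≤ approxNum T n ∧
      approxNum T n ≤ C * Real.exp (-Real.pi * (1 - α) * Real.sqrt (n / (2 * α))) := by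
  have hT' : ∀ (a : H2) (z : ℂ), ‖z‖ < 1 →
      fa (T a) z = fa a ((1 + Complex.exp ((α : ℂ) * Complex.log (1 - z)))⁻¹) :=
    fun a z hz => by rw [hT a z hz, hφ]
  obtain ⟨C, hC, H1⟩ := upper hα₀ hα₁ T hT'
  obtain ⟨c, hc, H2'⟩ := lower hα₀ hα₁ T hT'
  exact ⟨c, C, hc, hC, fun n hn => ⟨H2' n hn, H1 n hn⟩⟩

end
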